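/- Let a ≥ 0, p > 1 and N ≥ 5. If p is Sobolev subcritical for the fourth-order problem, i.e. 1 < p < (N+4+2a)/(N−4), then the fourth-order Hénon equation Δ²u = |x|^a u^p on ℝ^N has no positive solution with finite Morse index; in particular, there is no positive C⁴ solution that is stable outside some compact subset of ℝ^N. -/

import Mathlib

open MeasureTheory Real

/-- The Laplacian of a function on Euclidean space, as the sum of its second
partial derivatives in the coordinate directions. -/
noncomputable def lap {N : ℕ} (f : EuclideanSpace ℝ (Fin N) → ℝ)
    (x : EuclideanSpace ℝ (Fin N)) : ℝ :=
  ∑ i : Fin N,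
    fderiv ℝ (fun y => fderiv ℝ f y (EuclideanSpace.single i 1)) x (EuclideanSpace.single i 1)

abbrev Eu (N : ℕ) := EuclideanSpace ℝ (Fin N)

/-- Partial derivative. -/
noncomputable def pd {N : ℕ} (i : Fin N) (f : Eu N → ℝ) (x : Eu N) : ℝ :=
  fderiv ℝ f x (EuclideanSpace.single i 1)

section Calculus
variable {N : ℕ}

lemma lap_eq (f : Eu N → ℝ) (x : Eu N) : lap f x = ∑ i, pd i (pd i f) x := rfl

lemma pd_contDiff {n : ℕ} {f : Eu N → ℝ} (hf : ContDiff ℝ (n + 1) f) (i : Fin N) :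
    ContDiff ℝ n (pd i f) := by
  unfold pd
  exact (hf.fderiv_right (m := n) le_rfl).clm_apply contDiff_const

lemma pd_cont {f : Eu N → ℝ} (hf : ContDiff ℝ 1 f) (i : Fin N) : Continuous (pd i f) := by
  have : ContDiff ℝ ((0 : ℕ) + 1) f := by simpa using hf
  exact (pd_contDiff this i).continuous

lemma pd_c1 {f : Eu N → ℝ} (hf : ContDiff ℝ 2 f) (i : Fin N) : ContDiff ℝ 1 (pd i f) := by
  have h : ContDiff ℝ ((1 : ℕ) + 1) f := by
    convert hf using 1; norm_num
  simpa using pd_contDiff h i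

lemma pd_c2 {f : Eu N → ℝ} (hf : ContDiff ℝ 3 f) (i : Fin N) : ContDiff ℝ 2 (pd i f) := by
  have h : ContDiff ℝ ((2 : ℕ) + 1) f := by
    convert hf using 1; norm_num
  simpa using pd_contDiff h i

lemma pd_c3 {f : Eu N → ℝ} (hf : ContDiff ℝ 4 f) (i : Fin N) : ContDiff ℝ 3 (pd i f) := by
  have h : ContDiff ℝ ((3 : ℕ) + 1) f := by
    convert hf using 1; norm_num
  simpa using pd_contDiff h i

lemma lap_cont {f : Eu N → ℝ} (hf : ContDiff ℝ 2 f) : Continuous (lap f) := by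
  have : lap f = fun x => ∑ i, pd i (pd i f) x := rfl
  rw [this]
  exact continuous_finsetSum _ fun i _ => pd_cont (pd_c1 hf i) i

lemma lap_c2 {f : Eu N → ℝ} (hf : ContDiff ℝ 4 f) : ContDiff ℝ 2 (lap f) := by
  have : lap f = fun x => ∑ i, pd i (pd i f) x := rfl
  rw [this]
  exact ContDiff.sum fun i _ => pd_c2 (pd_c3 hf i) i

lemma pd_mul {f g : Eu N → ℝ} (hf : Differentiable ℝ f) (hg : Differentiable ℝ g) (i : Fin N) :
    pd i (fun x => f x * g x) = fun x => f x * pd i g x + g x * pd i f x := by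
  ext x
  unfold pd
  rw [fderiv_fun_mul (hf x) (hg x)]
  simp

lemma pd_add {f g : Eu N → ℝ} (hf : Differentiable ℝ f) (hg : Differentiable ℝ g) (i : Fin N) :
    pd i (fun x => f x + g x) = fun x => pd i f x + pd i g x := by
  ext x
  unfold pd
  rw [fderiv_fun_add (hf x) (hg x)]
  simp

lemma pd_sub {f g : Eu N → ℝ} (hf : Differentiable ℝ f) (hg : Differentiable ℝ g) (i : Fin N) :
    pd i (fun x => f x - g x) = fun x => pd i f x - pd i g x := by
  ext x
  unfold pd
  rw [fderiv_fun_sub (hf x) (hg x)]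
  simp

lemma pd_const_mul {f : Eu N → ℝ} (hf : Differentiable ℝ f) (c : ℝ) (i : Fin N) :
    pd i (fun x => c * f x) = fun x => c * pd i f x := by
  ext x
  unfold pd
  rw [fderiv_const_mul (hf x)]
  simp

lemma pd_sum {ι : Type*} (s : Finset ι) {f : ι → Eu N → ℝ} (hf : ∀ k, Differentiable ℝ (f k))
    (i : Fin N) :
    pd i (fun x => ∑ k ∈ s, f k x) = fun x => ∑ k ∈ s, pd i (f k) x := by
  ext x
  unfold pd
  rw [fderiv_fun_sum (fun k _ => hf k x)]
  simp

lemma pd_coord (i k : Fin N) : pd i (fun x : Eu N => x k) = fun _ => if k = i then 1 else 0 := by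
  ext x
  unfold pd
  have : HasFDerivAt (fun x : Eu N => x k) (EuclideanSpace.proj k : Eu N →L[ℝ] ℝ) x :=
    (EuclideanSpace.proj k : Eu N →L[ℝ] ℝ).hasFDerivAt
  rw [this.fderiv]
  simp

lemma coord_contDiff (k : Fin N) {n : WithTop ℕ∞} : ContDiff ℝ n (fun x : Eu N => x k) :=
  (EuclideanSpace.proj k : Eu N →L[ℝ] ℝ).contDiff

lemma pd_comm {f : Eu N → ℝ} (hf : ContDiff ℝ 2 f) (i j : Fin N) :
    pd i (pd j f) = pd j (pd i f) := by
  ext x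
  have hs := (hf.contDiffAt (x := x)).isSymmSndFDerivAt (by simp)
  have hd : DifferentiableAt ℝ (fderiv ℝ f) x :=
    ((hf.fderiv_right (m := 1) (by norm_num)).differentiable (by norm_num)) x
  have key : ∀ v w : Eu N, fderiv ℝ (fun y => fderiv ℝ f y v) x w
      = fderiv ℝ (fderiv ℝ f) x w v := by
    intro v w
    rw [fderiv_clm_apply hd (differentiableAt_const v)]
    simp
  unfold pd
  rw [key, key]
  exact hs _ _

lemma lap_mul {f g : Eu N → ℝ} (hf : ContDiff ℝ 2 f) (hg : ContDiff ℝ 2 g) :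
    lap (fun x => f x * g x)
      = fun x => f x * lap g x + 2 * (∑ i, pd i f x * pd i g x) + g x * lap f x := by
  have hf1 := hf.differentiable (by norm_num)
  have hg1 := hg.differentiable (by norm_num)
  ext x
  simp only [lap_eq]
  have : ∀ i, pd i (pd i (fun x => f x * g x)) x
      = f x * pd i (pd i g) x + 2 * (pd i f x * pd i g x) + g x * pd i (pd i f) x := by
    intro i
    have hfi := (pd_c1 hf i).differentiable (by norm_num)
    have hgi := (pd_c1 hg i).differentiable (by norm_num)
    rw [pd_mul hf1 hg1, pd_add (hf1.fun_mul hgi) (hg1.fun_mul hfi), pd_mul hf1 hgi, pd_mul hg1 hfi]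
    ring
  rw [Finset.sum_congr rfl fun i _ => this i, Finset.sum_add_distrib, Finset.sum_add_distrib,
    Finset.mul_sum, Finset.mul_sum, Finset.mul_sum]

lemma pd_hcs {f : Eu N → ℝ} (hf : HasCompactSupport f) (i : Fin N) :
    HasCompactSupport (pd i f) := by
  have := hf.fderiv_apply (𝕜 := ℝ) (EuclideanSpace.single i (1 : ℝ))
  exact this

lemma pd_zero_of_eventually {f : Eu N → ℝ} {x : Eu N} {c : ℝ}
    (h : f =ᶠ[nhds x] fun _ => c) (i : Fin N) : pd i f =ᶠ[nhds x] fun _ => 0 := by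
  filter_upwards [h.eventuallyEq_nhds] with y hy
  unfold pd
  rw [hy.fderiv_eq]; simp

lemma pd_congr {f g : Eu N → ℝ} {x : Eu N}
    (h : f =ᶠ[nhds x] g) (i : Fin N) : pd i f =ᶠ[nhds x] pd i g := by
  filter_upwards [h.eventuallyEq_nhds] with y hy
  unfold pd
  rw [hy.fderiv_eq]

lemma lap_congr {f g : Eu N → ℝ} {x : Eu N}
    (h : f =ᶠ[nhds x] g) : lap f x = lap g x := by
  simp only [lap_eq]
  exact Finset.sum_congr rfl fun i _ => (pd_congr (pd_congr h i) i).eq_of_nhds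

lemma lap_const (c : ℝ) (x : Eu N) : lap (fun _ : Eu N => c) x = 0 := by
  simp [lap]

lemma ibp {f g : Eu N → ℝ} (hf : ContDiff ℝ 1 f) (hg : ContDiff ℝ 1 g)
    (hc : HasCompactSupport g) (i : Fin N) :
    ∫ x, f x * pd i g x = - ∫ x, pd i f x * g x := by
  unfold pd
  apply integral_mul_fderiv_eq_neg_fderiv_mul_of_integrable
  · exact ((pd_cont hf i).mul hg.continuous).integrable_of_hasCompactSupport hc.mul_left
  · exact (hf.continuous.mul (pd_cont hg i)).integrable_of_hasCompactSupport (pd_hcs hc i).mul_left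
  · exact (hf.continuous.mul hg.continuous).integrable_of_hasCompactSupport hc.mul_left
  · exact fun x _ => hf.differentiable (by norm_num) x
  · exact fun x _ => hg.differentiable (by norm_num) x

lemma int_pd_zero {F : Eu N → ℝ} (hF : ContDiff ℝ 1 F) (hc : HasCompactSupport F) (i : Fin N) :
    ∫ x, pd i F x = 0 := by
  have h1 : ContDiff ℝ 1 (fun _ : Eu N => (1 : ℝ)) := contDiff_const
  have := ibp h1 hF hc i
  simpa [pd] using this

/-- Version only requiring differentiability and integrability. -/
lemma int_pd_zero' {F : Eu N → ℝ} (hF : Differentiable ℝ F) (h0 : Integrable F) (i : Fin N)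
    (h1 : Integrable (pd i F)) : ∫ x, pd i F x = 0 := by
  have := integral_mul_fderiv_eq_neg_fderiv_mul_of_integrable (μ := (volume : Measure (Eu N)))
    (f := fun _ : Eu N => (1 : ℝ)) (g := F) (v := EuclideanSpace.single i 1)
    (by simp) (by unfold pd at h1; simpa using h1) (by simpa using h0) (fun x _ => by simp) (fun x _ => hF x)
  simpa [pd] using this

lemma int_cc {f : Eu N → ℝ} (hf : Continuous f) (hc : HasCompactSupport f) : Integrable f :=
  hf.integrable_of_hasCompactSupport hc

lemma lap_hcs {f : Eu N → ℝ} (hf : HasCompactSupport f) : HasCompactSupport (lap f) := by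
  apply HasCompactSupport.intro hf (f := lap f)
  intro x hx
  have h : f =ᶠ[nhds x] fun _ => 0 := by
    rw [notMem_tsupport_iff_eventuallyEq] at hx
    exact hx
  rw [lap_congr h, lap_const]

/-- Green identity. -/
lemma green {w v : Eu N → ℝ} (hw : ContDiff ℝ 2 w) (hv : ContDiff ℝ 2 v)
    (hc : HasCompactSupport v) : ∫ x, lap w x * v x = ∫ x, w x * lap v x := by
  have h1 : ∀ i, ∫ x, pd i (pd i w) x * v x = ∫ x, w x * pd i (pd i v) x := by
    intro i
    have a1 := ibp (pd_c1 hw i) (hv.of_le (by norm_num)) hc i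
    have a2 := ibp (hw.of_le (by norm_num)) (pd_c1 hv i) (pd_hcs hc i) i
    rw [a2, ← neg_eq_iff_eq_neg.mpr a1]
  simp only [lap_eq, Finset.sum_mul, Finset.mul_sum]
  rw [integral_finsetSum, integral_finsetSum]
  · exact Finset.sum_congr rfl fun i _ => h1 i
  · intro i _
    exact int_cc (hw.continuous.mul (pd_cont (pd_c1 hv i) i)) (pd_hcs (pd_hcs hc i) i).mul_left
  · intro i _
    exact int_cc ((pd_cont (pd_c1 hw i) i).mul hv.continuous) hc.mul_left

/-- `∫ |D²v|² = ∫ (Δv)²`. -/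
lemma hess_eq {v : Eu N → ℝ} (hv : ContDiff ℝ 4 v) (hc : HasCompactSupport v) :
    ∫ x, ∑ i, ∑ j, (pd i (pd j v) x) ^ 2 = ∫ x, (lap v x) ^ 2 := by
  have c3 := fun i => pd_c3 hv i
  have c2 := fun i j => pd_c2 (c3 i) j
  have k1 := fun i => pd_hcs hc i
  have k2 := fun i j => pd_hcs (k1 i) j
  have h : ∀ i j, ∫ x, (pd i (pd j v) x) ^ 2 = ∫ x, pd i (pd i v) x * pd j (pd j v) x := by
    intro i j
    have a1 := ibp (c2 j i |>.of_le (by norm_num)) (c3 j |>.of_le (by norm_num)) (k1 j) i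
    have a2 := ibp (c2 i i |>.of_le (by norm_num)) (c3 j |>.of_le (by norm_num)) (k1 j) j
    have e : pd i (pd i (pd j v)) = pd j (pd i (pd i v)) := by
      rw [pd_comm (hv.of_le (by norm_num)) i j, pd_comm ((c3 i).of_le (by norm_num)) i j]
    simp only [pow_two]
    rw [a1, a2, e]
  have e1 : ∀ x, (lap v x) ^ 2 = ∑ i, ∑ j, pd i (pd i v) x * pd j (pd j v) x := by
    intro x
    rw [pow_two, lap_eq, Finset.sum_mul_sum]
  simp only [e1]
  rw [integral_finsetSum, integral_finsetSum]
  · refine Finset.sum_congr rfl fun i _ => ?_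
    rw [integral_finsetSum, integral_finsetSum]
    · exact Finset.sum_congr rfl fun j _ => h i j
    · intro j _
      exact int_cc ((c2 i i).continuous.mul (c2 j j).continuous) (k2 i i).mul_right
    · intro j _
      refine int_cc ((c2 j i).continuous.pow 2) ?_
      simp only [pow_two]; exact (k2 j i).mul_right
  · intro i _
    refine integrable_finsetSum _ fun j _ => ?_
    exact int_cc ((c2 i i).continuous.mul (c2 j j).continuous) (k2 i i).mul_right
  · intro i _
    refine integrable_finsetSum _ fun j _ => ?_
    refine int_cc ((c2 j i).continuous.pow 2) ?_
    simp only [pow_two]; exact (k2 j i).mul_right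

/-- Scaling. -/
noncomputable def sc (R : ℝ) (g : Eu N → ℝ) : Eu N → ℝ := fun x => g (R⁻¹ • x)

lemma sc_contDiff {n : WithTop ℕ∞} {g : Eu N → ℝ} (hg : ContDiff ℝ n g) (R : ℝ) :
    ContDiff ℝ n (sc R g) := hg.comp (contDiff_const_smul R⁻¹)

lemma sc_hcs {g : Eu N → ℝ} (hg : HasCompactSupport g) {R : ℝ} (hR : 0 < R) :
    HasCompactSupport (sc R g) := hg.comp_smul (inv_ne_zero hR.ne')

lemma pd_sc (R : ℝ) (g : Eu N → ℝ) (i : Fin N) :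
    pd i (sc R g) = fun x => R⁻¹ * sc R (pd i g) x := by
  ext x
  unfold pd sc
  rw [fderiv_comp_smul]
  simp

lemma lap_sc (R : ℝ) {g : Eu N → ℝ} (hg : ContDiff ℝ 2 g) :
    lap (sc R g) = fun x => R⁻¹ ^ 2 * sc R (lap g) x := by
  ext x
  have : sc R (lap g) x = ∑ i, sc R (pd i (pd i g)) x := rfl
  rw [this, lap_eq, Finset.mul_sum]
  refine Finset.sum_congr rfl fun i _ => ?_
  rw [pd_sc, pd_const_mul ((sc_contDiff (pd_c1 hg i) R).differentiable (by norm_num)), pd_sc]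
  ring

end Calculus

section Ineq
variable {N : ℕ}

/-- Gradient product. -/
noncomputable def gd (f g : Eu N → ℝ) (x : Eu N) : ℝ := ∑ i, pd i f x * pd i g x

/-- Squared gradient. -/
noncomputable def chi (g : Eu N → ℝ) (x : Eu N) : ℝ := ∑ i, (pd i g x) ^ 2

lemma int_van {f η : Eu N → ℝ} (hf : Continuous f) (hη : HasCompactSupport η)
    (h : ∀ x, x ∉ tsupport η → f x = 0) : Integrable f :=
  int_cc hf (HasCompactSupport.intro hη h)

lemma ev_zero {η : Eu N → ℝ} {x : Eu N} (hx : x ∉ tsupport η) :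
    η =ᶠ[nhds x] fun _ => 0 := by
  rw [notMem_tsupport_iff_eventuallyEq] at hx
  exact hx

lemma chi_const_ev {η : Eu N → ℝ} {x : Eu N} {c : ℝ} (h : η =ᶠ[nhds x] fun _ => c) :
    chi η =ᶠ[nhds x] fun _ => 0 := by
  have h2 := fun i => (pd_zero_of_eventually h i)
  have h3 : ∀ᶠ y in nhds x, ∀ i, pd i η y = 0 := by
    rw [Filter.eventually_all]; exact h2
  filter_upwards [h3] with y hy
  simp [chi, hy]

lemma chi_c3 {η : Eu N → ℝ} (hη : ContDiff ℝ 4 η) : ContDiff ℝ 3 (chi η) := by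
  unfold chi
  exact ContDiff.sum fun i _ => (pd_c3 hη i).pow 2

lemma gd_cont {f g : Eu N → ℝ} (hf : ContDiff ℝ 1 f) (hg : ContDiff ℝ 1 g) :
    Continuous (gd f g) := by
  unfold gd
  exact continuous_finsetSum _ fun i _ => (pd_cont hf i).mul (pd_cont hg i)

lemma van_all {η : Eu N → ℝ} {x : Eu N} {c : ℝ} (h : η =ᶠ[nhds x] fun _ => c) :
    (∀ i, pd i η x = 0) ∧ lap η x = 0 ∧ chi η x = 0 ∧ lap (chi η) x = 0 := by
  refine ⟨fun i => (pd_zero_of_eventually h i).eq_of_nhds, ?_, (chi_const_ev h).eq_of_nhds, ?_⟩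
  · rw [lap_congr h, lap_const]
  · rw [lap_congr (chi_const_ev h), lap_const]

lemma gd_sq_le (u η : Eu N → ℝ) (x : Eu N) : (gd u η x) ^ 2 ≤ chi u x * chi η x := by
  unfold gd chi
  exact Finset.sum_mul_sq_le_sq_mul_sq _ _ _

lemma chi_nonneg (η : Eu N → ℝ) (x : Eu N) : 0 ≤ chi η x :=
  Finset.sum_nonneg fun _ _ => sq_nonneg _

lemma gd_zero {u η : Eu N → ℝ} {x : Eu N} (h : ∀ i, pd i η x = 0) : gd u η x = 0 := by
  simp [gd, h]

lemma lemB {u η : Eu N → ℝ} (hu : ContDiff ℝ 4 u) (hη : ContDiff ℝ 4 η)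
    (hc : HasCompactSupport η) :
    ∫ x, (2 * gd u η x + u x * lap η x) ^ 2 ≤
      ∫ x, (4 * (u x ^ 2 * lap (chi η) x) - 8 * (u x * lap u x * chi η x)
        + 2 * (u x ^ 2 * (lap η x) ^ 2)) := by
  have c0 := hu.continuous
  have c1 := lap_cont (hu.of_le (m := 2) (by norm_num))
  have c2 := lap_cont (hη.of_le (m := 2) (by norm_num))
  have c3 := lap_cont ((chi_c3 hη).of_le (m := 2) (by norm_num))
  have c4 := (chi_c3 hη).continuous
  have c5 := gd_cont (hu.of_le (m := 1) (by norm_num)) (hη.of_le (m := 1) (by norm_num))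
  have c6 := (chi_c3 hu).continuous
  have van := fun x (hx : x ∉ tsupport η) => van_all (ev_zero hx)
  have hcchi : HasCompactSupport (chi η) :=
    HasCompactSupport.intro hc fun x hx => (van x hx).2.2.1
  -- Green
  have hu2 : ContDiff ℝ 2 u := hu.of_le (by norm_num)
  have G := green (w := fun x => u x * u x) (hu2.mul hu2)
    ((chi_c3 hη).of_le (m := 2) (by norm_num)) hcchi
  rw [lap_mul hu2 hu2] at G
  have i1 : Integrable (fun x => chi u x * chi η x) :=
    int_van (by fun_prop) hc fun x hx => by simp [(van x hx).2.2.1]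
  have i2 : Integrable (fun x => u x * lap u x * chi η x) :=
    int_van (by fun_prop) hc fun x hx => by simp [(van x hx).2.2.1]
  have i3 : Integrable (fun x => u x ^ 2 * lap (chi η) x) :=
    int_van (by fun_prop) hc fun x hx => by simp [(van x hx).2.2.2]
  have i4 : Integrable (fun x => u x ^ 2 * (lap η x) ^ 2) :=
    int_van (by fun_prop) hc fun x hx => by simp [(van x hx).2.1]
  have i5 : Integrable (fun x => (2 * gd u η x + u x * lap η x) ^ 2) :=
    int_van (by fun_prop) hc fun x hx => by simp [(van x hx).2.1, gd_zero (van x hx).1]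
  have G2 : ∫ x, (u x ^ 2 * lap (chi η) x) =
      2 * (∫ x, u x * lap u x * chi η x) + 2 * ∫ x, chi u x * chi η x := by
    rw [← integral_const_mul, ← integral_const_mul, ← integral_add (i2.const_mul 2) (i1.const_mul 2)]
    simp only [pow_two]
    rw [← G]
    congr 1
    ext x
    simp only [chi]
    have : ∑ i, pd i u x * pd i u x = ∑ i, pd i u x ^ 2 := by simp [pow_two]
    rw [this]
    ring
  have P : ∫ x, (2 * gd u η x + u x * lap η x) ^ 2 ≤
      ∫ x, (8 * (chi u x * chi η x) + 2 * (u x ^ 2 * (lap η x) ^ 2)) := by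
    apply integral_mono i5 ((i1.const_mul 8).add (i4.const_mul 2))
    intro x
    have := gd_sq_le u η x
    simp only [Pi.add_apply]
    nlinarith [sq_nonneg (2 * gd u η x - u x * lap η x)]
  have I1 := integral_add (i1.const_mul 8) (i4.const_mul 2)
  have I2 := integral_add ((i3.const_mul 4).sub (i2.const_mul 8)) (i4.const_mul 2)
  have I3 := integral_sub (i3.const_mul 4) (i2.const_mul 8)
  simp only [Pi.sub_apply] at I2
  rw [I2, I3]
  rw [I1] at P
  simp only [integral_const_mul] at P ⊢
  linarith

/-- The basic stability estimate. -/
lemma lemS {a p : ℝ} (ha : 0 ≤ a) (hp : 1 < p) {u η : Eu N → ℝ} (hu : ContDiff ℝ 4 u)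
    (hpos : ∀ x, 0 < u x) (heq : ∀ x, lap (lap u) x = ‖x‖ ^ a * u x ^ p)
    (hη : ContDiff ℝ 4 η) (hc : HasCompactSupport η)
    (hst : 0 ≤ (∫ x, (lap (fun x => u x * η x) x) ^ 2)
        - p * ∫ x, ‖x‖ ^ a * u x ^ (p - 1) * (u x * η x) ^ 2) :
    ∫ x, ((lap u x) ^ 2 + ‖x‖ ^ a * u x ^ (p + 1)) * (η x) ^ 2 ≤
      (3 * (p / (p - 1)) + 2) *
        ∫ x, ((2 * gd u η x + u x * lap η x) ^ 2 + 2 * (|u x * lap u x| * chi η x)) := by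
  have c0 := hu.continuous
  have c1 := lap_cont (hu.of_le (m := 2) (by norm_num))
  have c2 := lap_cont (hη.of_le (m := 2) (by norm_num))
  have c4 := (chi_c3 hη).continuous
  have c5 := gd_cont (hu.of_le (m := 1) (by norm_num)) (hη.of_le (m := 1) (by norm_num))
  have c6 : Continuous η := hη.continuous
  have cW : Continuous (fun x : Eu N => ‖x‖ ^ a * u x ^ (p + 1)) :=
    (continuous_norm.rpow_const fun x => Or.inr ha).mul
      (c0.rpow_const fun x => Or.inl (hpos x).ne')
  have van := fun x (hx : x ∉ tsupport η) => van_all (ev_zero hx)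
  have van0 := fun x (hx : x ∉ tsupport η) => (ev_zero hx).eq_of_nhds
  have hu2 : ContDiff ℝ 2 u := hu.of_le (by norm_num)
  have hη2 : ContDiff ℝ 2 η := hη.of_le (by norm_num)
  have hηη : ContDiff ℝ 2 (fun x => η x * η x) := hη2.mul hη2
  have e1 : ∀ x, ‖x‖ ^ a * u x ^ (p - 1) * (u x * η x) ^ 2
      = ‖x‖ ^ a * u x ^ (p + 1) * η x ^ 2 := by
    intro x
    have : u x ^ (p + 1) = u x ^ (p - 1) * u x ^ 2 := by
      rw [← Real.rpow_natCast (u x) 2, ← Real.rpow_add (hpos x)]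
      congr 1; push_cast; ring
    rw [this]; ring
  simp only [e1] at hst
  -- the equation tested with u η²
  have hv : ContDiff ℝ 2 (fun x => u x * (η x * η x)) := hu2.mul hηη
  have hvc : HasCompactSupport (fun x => u x * (η x * η x)) := by
    exact (hc.mul_left (f := η)).mul_left
  have G := green (lap_c2 hu) hv hvc
  have e2 : ∀ x, lap (lap u) x * (u x * (η x * η x)) = ‖x‖ ^ a * u x ^ (p + 1) * η x ^ 2 := by
    intro x
    rw [heq x, Real.rpow_add (hpos x), Real.rpow_one]; ring
  simp only [e2] at G
  -- pointwise identities
  have e3 : ∀ x, lap (fun x => u x * η x) x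
      = u x * lap η x + 2 * gd u η x + η x * lap u x := by
    intro x; rw [lap_mul hu2 hη2]; rfl
  have e4 : ∀ x, lap u x * lap (fun x => u x * (η x * η x)) x
      = (lap (fun x => u x * η x) x) ^ 2 - (2 * gd u η x + u x * lap η x) ^ 2
        + 2 * (u x * lap u x * chi η x) := by
    intro x
    rw [e3 x, lap_mul hu2 hηη, lap_mul hη2 hη2]
    have hd := hη2.differentiable (by norm_num)
    have : ∑ i, pd i u x * pd i (fun x => η x * η x) x = 2 * η x * gd u η x := by
      unfold gd
      rw [Finset.mul_sum]
      refine Finset.sum_congr rfl fun i _ => ?_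
      rw [pd_mul hd hd]; ring
    have h2 : ∑ i, pd i η x * pd i η x = chi η x := by
      simp [chi, pow_two]
    simp only [this, h2]
    ring
  have c7 : Continuous (lap (fun x => u x * η x)) := lap_cont (hu2.mul hη2)
  have i1 : Integrable (fun x => (lap (fun x => u x * η x) x) ^ 2) := by
    refine int_van (by fun_prop) hc fun x hx => ?_
    rw [e3, (van x hx).2.1, gd_zero (van x hx).1, van0 x hx]; simp
  have i2 : Integrable (fun x => (2 * gd u η x + u x * lap η x) ^ 2) :=
    int_van (by fun_prop) hc fun x hx => by simp [(van x hx).2.1, gd_zero (van x hx).1]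
  have i3 : Integrable (fun x => u x * lap u x * chi η x) :=
    int_van (by fun_prop) hc fun x hx => by simp [(van x hx).2.2.1]
  have i4 : Integrable (fun x => |u x * lap u x| * chi η x) :=
    int_van (by fun_prop) hc fun x hx => by simp [(van x hx).2.2.1]
  have i5 : Integrable (fun x => ‖x‖ ^ a * u x ^ (p + 1) * η x ^ 2) :=
    int_van (by fun_prop) hc fun x hx => by simp [van0 x hx]
  have i6 : Integrable (fun x => lap u x ^ 2 * η x ^ 2) :=
    int_van (by fun_prop) hc fun x hx => by simp [van0 x hx]
  simp only [e4] at G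
  have I1 := integral_add (i1.sub i2) (i3.const_mul 2)
  have I2 := integral_sub i1 i2
  simp only [Pi.sub_apply] at I1
  rw [I1, I2, integral_const_mul] at G
  have I3 := integral_add i2 (i4.const_mul 2)
  rw [integral_const_mul] at I3
  have I4 := integral_add i6 i5
  have e5 : ∀ x, ((lap u x) ^ 2 + ‖x‖ ^ a * u x ^ (p + 1)) * (η x) ^ 2
      = lap u x ^ 2 * η x ^ 2 + ‖x‖ ^ a * u x ^ (p + 1) * η x ^ 2 := fun x => by ring
  simp only [e5]
  rw [I3, I4]
  have A1 : - ∫ x, u x * lap u x * chi η x ≤ ∫ x, |u x * lap u x| * chi η x := by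
    rw [← integral_neg]
    refine integral_mono i3.neg i4 fun x => ?_
    simp only
    rw [← neg_mul]
    exact mul_le_mul_of_nonneg_right (neg_le_abs _) (chi_nonneg _ _)
  have A2 : ∫ x, lap u x ^ 2 * η x ^ 2 ≤ 2 * (∫ x, (lap (fun x => u x * η x) x) ^ 2)
      + 2 * ∫ x, (2 * gd u η x + u x * lap η x) ^ 2 := by
    rw [← integral_const_mul, ← integral_const_mul,
      ← integral_add (i1.const_mul 2) (i2.const_mul 2)]
    refine integral_mono i6 ((i1.const_mul 2).add (i2.const_mul 2)) fun x => ?_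
    simp only [e3]
    nlinarith [sq_nonneg (u x * lap η x + 2 * gd u η x + η x * lap u x
      + (2 * gd u η x + u x * lap η x))]
  have A3 : 0 ≤ ∫ x, |u x * lap u x| * chi η x :=
    integral_nonneg fun x => mul_nonneg (abs_nonneg _) (chi_nonneg _ _)
  have A4 : 0 ≤ ∫ x, (2 * gd u η x + u x * lap η x) ^ 2 := integral_nonneg fun x => sq_nonneg _
  generalize (∫ x, (lap (fun x => u x * η x) x) ^ 2) = P at *
  generalize (∫ x, (2 * gd u η x + u x * lap η x) ^ 2) = B at *
  generalize (∫ x, |u x * lap u x| * chi η x) = Z at *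
  generalize (∫ x, u x * lap u x * chi η x) = Z' at *
  generalize (∫ x, lap u x ^ 2 * η x ^ 2) = X at *
  generalize (∫ x, ‖x‖ ^ a * u x ^ (p + 1) * η x ^ 2) = Y at *
  have hp1 : 0 < p - 1 := by linarith
  set Q := B + 2 * Z with hQ
  have h1 : P ≤ Y + Q := by linarith
  have h2 : (p - 1) * Y ≤ Q := by linarith
  have h3 : Y ≤ Q / (p - 1) := by rw [le_div_iff₀ hp1]; linarith
  have h4 : p / (p - 1) = 1 + 1 / (p - 1) := by field_simp; ring
  have h5 : X ≤ 2 * P + 2 * Q := by linarith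
  have h6 : Q / (p - 1) = 1 / (p - 1) * Q := by ring
  rw [h4]
  rw [h6] at h3
  have h7 : 0 ≤ Q := by linarith
  linarith

end Ineq

section Cutoff
open scoped ContDiff
variable {N : ℕ}

lemma pd_smooth {f : Eu N → ℝ} (hf : ContDiff ℝ ∞ f) (i : Fin N) : ContDiff ℝ ∞ (pd i f) := by
  unfold pd
  exact (hf.fderiv_right (m := ∞) (by simp)).clm_apply contDiff_const

lemma smooth_to {f : Eu N → ℝ} (hf : ContDiff ℝ ∞ f) (n : ℕ) : ContDiff ℝ n f :=
  hf.of_le (by exact_mod_cast le_top)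

lemma smooth4 {f : Eu N → ℝ} (hf : ContDiff ℝ ∞ f) : ContDiff ℝ 4 f := smooth_to hf 4

lemma pd_pow_mul {ζ f : Eu N → ℝ} (hζ : ContDiff ℝ ∞ ζ) (hf : ContDiff ℝ ∞ f) (k : ℕ) (i : Fin N) :
    ∃ g : Eu N → ℝ, ContDiff ℝ ∞ g ∧
      pd i (fun x => ζ x ^ (k + 1) * f x) = fun x => ζ x ^ k * g x := by
  refine ⟨fun x => ζ x * pd i f x + f x * ((k + 1 : ℝ) * pd i ζ x), ?_, ?_⟩
  · have h1 := pd_smooth hf i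
    have h2 := pd_smooth hζ i
    fun_prop
  · have hd : Differentiable ℝ ζ := hζ.differentiable (by simp)
    have hdf : Differentiable ℝ f := hf.differentiable (by simp)
    rw [pd_mul (hd.fun_pow (k + 1)) hdf]
    ext x
    have : pd i (fun x => ζ x ^ (k + 1)) x = (k + 1 : ℝ) * ζ x ^ k * pd i ζ x := by
      unfold pd
      rw [fderiv_fun_pow (k + 1) (hd x)]
      simp
    rw [this]
    ring

lemma lap_pow_mul {ζ f : Eu N → ℝ} (hζ : ContDiff ℝ ∞ ζ) (hf : ContDiff ℝ ∞ f) (k : ℕ) :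
    ∃ g : Eu N → ℝ, ContDiff ℝ ∞ g ∧
      lap (fun x => ζ x ^ (k + 2) * f x) = fun x => ζ x ^ k * g x := by
  have h : ∀ i, ∃ g : Eu N → ℝ, ContDiff ℝ ∞ g ∧
      pd i (pd i (fun x => ζ x ^ (k + 2) * f x)) = fun x => ζ x ^ k * g x := by
    intro i
    obtain ⟨g, hg, e⟩ := pd_pow_mul hζ hf (k + 1) i
    obtain ⟨g', hg', e'⟩ := pd_pow_mul hζ hg k i
    exact ⟨g', hg', by rw [e, e']⟩
  choose g hg e using h
  refine ⟨fun x => ∑ i, g i x, ContDiff.sum fun i _ => hg i, ?_⟩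
  ext x
  rw [lap_eq, Finset.mul_sum]
  exact Finset.sum_congr rfl fun i _ => by rw [e i]

lemma bdd_ball {g : Eu N → ℝ} (hg : Continuous g) (r : ℝ) :
    ∃ C, 0 ≤ C ∧ ∀ y : Eu N, ‖y‖ ≤ r → |g y| ≤ C := by
  obtain ⟨C, hC⟩ := (isCompact_closedBall (0 : Eu N) r).exists_bound_of_continuousOn hg.continuousOn
  refine ⟨max C 0, le_max_right _ _, fun y hy => ?_⟩
  exact (hC y (by simpa using hy)).trans (le_max_left _ _)

/-- basic cutoff -/
lemma exists_zeta (N : ℕ) : ∃ ζ : Eu N → ℝ, ContDiff ℝ ∞ ζ ∧ (∀ y, 0 ≤ ζ y) ∧ (∀ y, ζ y ≤ 1) ∧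
    (∀ y, ‖y‖ ≤ 1 → ζ y = 1) ∧ (∀ y, 2 ≤ ‖y‖ → ζ y = 0) := by
  let f : ContDiffBump (0 : Eu N) := ⟨1, 2, by norm_num, by norm_num⟩
  refine ⟨f, f.contDiff, fun y => f.nonneg, fun y => f.le_one, fun y hy => ?_, fun y hy => ?_⟩
  · exact f.one_of_mem_closedBall (by simpa using hy)
  · exact f.zero_of_le_dist (by simpa using hy)

lemma hcs_of_zero {f : Eu N → ℝ} {r : ℝ} (h : ∀ y, r ≤ ‖y‖ → f y = 0) : HasCompactSupport f := by
  refine HasCompactSupport.intro (isCompact_closedBall (0 : Eu N) r) fun y hy => h y ?_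
  simp only [Metric.mem_closedBall, dist_zero_right, not_le] at hy
  exact hy.le

lemma ev_of_lt {f : Eu N → ℝ} {r c : ℝ} (h : ∀ y, ‖y‖ ≤ r → f y = c) {y : Eu N} (hy : ‖y‖ < r) :
    f =ᶠ[nhds y] fun _ => c := by
  filter_upwards [(isOpen_lt continuous_norm continuous_const).mem_nhds hy] with z hz
  exact h z (le_of_lt hz)

lemma ev_of_gt {f : Eu N → ℝ} {r c : ℝ} (h : ∀ y, r ≤ ‖y‖ → f y = c) {y : Eu N} (hy : r < ‖y‖) :
    f =ᶠ[nhds y] fun _ => c := by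
  filter_upwards [(isOpen_lt continuous_const continuous_norm).mem_nhds hy] with z hz
  exact h z (le_of_lt hz)

lemma cutoff_pow {ζ : Eu N → ℝ} (hζ : ContDiff ℝ ∞ ζ) (h0 : ∀ y, 0 ≤ ζ y)
    (h2 : ∀ y, 2 ≤ ‖y‖ → ζ y = 0) (n : ℕ) :
    ∃ C, 0 ≤ C ∧ ∀ y, chi (fun x => ζ x ^ (n + 2)) y ≤ C * (ζ y ^ (n + 2) * ζ y ^ n) ∧
      |lap (chi (fun x => ζ x ^ (n + 2))) y| ≤ C * (ζ y ^ n) ^ 2 ∧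
      |lap (fun x => ζ x ^ (n + 2)) y| ≤ C * ζ y ^ n := by
  have hone : ContDiff ℝ ∞ (fun _ : Eu N => (1 : ℝ)) := contDiff_const
  obtain ⟨g1, hg1, e1⟩ := lap_pow_mul hζ hone n
  have h := fun i => pd_pow_mul hζ hone (n + 1) i
  simp only [mul_one] at e1 h
  choose f hf e using h
  have echi : chi (fun x => ζ x ^ (n + 2)) = fun x => ζ x ^ (2 * n + 2) * ∑ i, (f i x) ^ 2 := by
    ext x
    unfold chi
    rw [Finset.mul_sum]
    refine Finset.sum_congr rfl fun i _ => ?_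
    have : pd i (fun x => ζ x ^ (n + 2)) = _ := e i
    rw [this]; ring
  have hs : ContDiff ℝ ∞ (fun x => ∑ i, (f i x) ^ 2) := ContDiff.sum fun i _ => (hf i).pow 2
  obtain ⟨g2, hg2, e2⟩ := lap_pow_mul hζ hs (2 * n)
  obtain ⟨C1, hC1, b1⟩ := bdd_ball hg1.continuous 2
  obtain ⟨C2, hC2, b2⟩ := bdd_ball hg2.continuous 2
  obtain ⟨C3, hC3, b3⟩ := bdd_ball hs.continuous 2
  refine ⟨C1 + C2 + C3, by positivity, fun y => ?_⟩
  have hz := h0 y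
  by_cases hy : ‖y‖ ≤ 2
  · refine ⟨?_, ?_, ?_⟩
    · rw [echi]
      have b := (le_abs_self _).trans (b3 y hy)
      calc ζ y ^ (2 * n + 2) * ∑ i, (f i y) ^ 2 ≤ ζ y ^ (2 * n + 2) * (C1 + C2 + C3) := by
            gcongr; linarith
        _ = _ := by ring
    · rw [echi, e2]
      simp only [abs_mul, abs_of_nonneg (pow_nonneg hz _)]
      calc ζ y ^ (2 * n) * |g2 y| ≤ ζ y ^ (2 * n) * (C1 + C2 + C3) := by
            gcongr; linarith [b2 y hy]
        _ = _ := by ring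
    · rw [e1]
      simp only [abs_mul, abs_of_nonneg (pow_nonneg hz _)]
      calc ζ y ^ n * |g1 y| ≤ ζ y ^ n * (C1 + C2 + C3) := by
            gcongr; linarith [b1 y hy]
        _ = _ := by ring
  · push Not at hy
    have hv : ∀ y, 2 ≤ ‖y‖ → (fun x => ζ x ^ (n + 2)) y = 0 := fun y hy => by simp [h2 y hy]
    obtain ⟨_, v2, v3, v4⟩ := van_all (ev_of_gt hv hy)
    rw [v2, v3, v4]
    refine ⟨by positivity, by simp; positivity, by simp; positivity⟩

lemma chi_sc (R : ℝ) (η : Eu N → ℝ) : chi (sc R η) = fun x => R⁻¹ ^ 2 * sc R (chi η) x := by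
  ext x
  have : sc R (chi η) x = ∑ i, (sc R (pd i η) x) ^ 2 := rfl
  rw [this, Finset.mul_sum]
  unfold chi
  exact Finset.sum_congr rfl fun i _ => by rw [pd_sc]; ring

lemma lap_const_mul {f : Eu N → ℝ} (hf : ContDiff ℝ 2 f) (c : ℝ) :
    lap (fun x => c * f x) = fun x => c * lap f x := by
  have hc : ContDiff ℝ 2 (fun _ : Eu N => c) := contDiff_const
  rw [lap_mul hc hf]
  ext x
  have : ∀ i, pd i (fun _ : Eu N => c) x = 0 := fun i => by simp [pd]
  simp [this, lap_const]

lemma lap_chi_sc (R : ℝ) {η : Eu N → ℝ} (hη : ContDiff ℝ 4 η) :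
    lap (chi (sc R η)) = fun x => R⁻¹ ^ 4 * sc R (lap (chi η)) x := by
  have h2 : ContDiff ℝ 2 (chi η) := (chi_c3 hη).of_le (by norm_num)
  rw [chi_sc, lap_const_mul (sc_contDiff h2 R), lap_sc R h2]
  ext x; ring

lemma lemY {a p : ℝ} (ha : 0 ≤ a) (hp : 1 < p) {n : ℕ} (hn : 4 / (p - 1) ≤ n) {ε : ℝ} (hε : 0 < ε) :
    ∃ C, 0 ≤ C ∧ ∀ R r t z : ℝ, 0 < R → R / 4 ≤ r → 0 < t → 0 ≤ z → z ≤ 1 →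
      R⁻¹ ^ 4 * (t ^ 2 * z ^ (2 * n)) ≤
        ε * (r ^ a * t ^ (p + 1) * z ^ (2 * n + 4)) + C * R ^ (-4 - (8 + 2 * a) / (p - 1)) := by
  have hp1 : 0 < p - 1 := by linarith
  refine ⟨(ε⁻¹ * 4 ^ a) ^ (2 / (p - 1)), by positivity, ?_⟩
  intro R r t z hR hr ht hz hz1
  have hr0 : 0 < r := by linarith
  by_cases h : R⁻¹ ^ 4 * (t ^ 2 * z ^ (2 * n)) ≤ ε * (r ^ a * t ^ (p + 1) * z ^ (2 * n + 4))
  · have : 0 ≤ (ε⁻¹ * 4 ^ a) ^ (2 / (p - 1)) * R ^ (-4 - (8 + 2 * a) / (p - 1)) := by positivity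
    linarith
  push Not at h
  have hn0 : n ≠ 0 := by
    rintro rfl
    have : 0 < 4 / (p - 1) := by positivity
    simp at hn; linarith
  have hz0 : 0 < z := by
    rcases hz.eq_or_lt with h0 | h0
    · subst h0
      simp [hn0] at h
    · exact h0
  have e1 : t ^ (p + 1) = t ^ (p - 1) * t ^ 2 := by
    rw [← Real.rpow_natCast t 2, ← Real.rpow_add ht]
    congr 1; push_cast; ring
  rw [e1] at h
  have h1 : ε * r ^ a * (t ^ (p - 1) * z ^ 4) < R⁻¹ ^ 4 := by
    have hpos : 0 < t ^ 2 * z ^ (2 * n) := by positivity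
    refine lt_of_mul_lt_mul_right ?_ hpos.le
    calc _ = ε * (r ^ a * (t ^ (p - 1) * t ^ 2) * z ^ (2 * n + 4)) := by ring
      _ < _ := h
  set s := t ^ (p - 1) * z ^ 4 with hs
  have hs0 : 0 < s := by positivity
  have h2 : s ≤ (ε⁻¹ * 4 ^ a) * R ^ (-4 - a) := by
    have hra : (R / 4) ^ a ≤ r ^ a := Real.rpow_le_rpow (by positivity) hr ha
    have h3 : ε * (R / 4) ^ a * s ≤ R⁻¹ ^ 4 :=
      (mul_le_mul_of_nonneg_right (mul_le_mul_of_nonneg_left hra hε.le) hs0.le).trans h1.le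
    rw [Real.div_rpow hR.le (by norm_num)] at h3
    have h4 : R ^ (-4 - a) = R⁻¹ ^ 4 * (R ^ a)⁻¹ := by
      rw [Real.rpow_sub hR, Real.rpow_neg hR.le, div_eq_mul_inv]
      congr 1
      rw [inv_pow]; norm_cast
    rw [h4]
    have h4a : 0 < (4 : ℝ) ^ a := by positivity
    have hRa : 0 < R ^ a := by positivity
    calc s = (ε * (R ^ a / 4 ^ a) * s) * (ε⁻¹ * 4 ^ a * (R ^ a)⁻¹) := by field_simp
      _ ≤ R⁻¹ ^ 4 * (ε⁻¹ * 4 ^ a * (R ^ a)⁻¹) := by gcongr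
      _ = _ := by ring
  have h5 : s ^ (2 / (p - 1)) ≤ (ε⁻¹ * 4 ^ a) ^ (2 / (p - 1)) * R ^ (-((8 + 2 * a) / (p - 1))) := by
    have := Real.rpow_le_rpow hs0.le h2 (z := 2 / (p - 1)) (by positivity)
    rw [Real.mul_rpow (x := ε⁻¹ * 4 ^ a) (by positivity) (by positivity),
      ← Real.rpow_mul hR.le] at this
    have e : (-4 - a) * (2 / (p - 1)) = -((8 + 2 * a) / (p - 1)) := by ring
    rwa [e] at this
  have h6 : s ^ (2 / (p - 1)) = t ^ 2 * z ^ (8 / (p - 1)) := by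
    rw [hs, Real.mul_rpow (by positivity) (by positivity), ← Real.rpow_mul ht.le,
      ← Real.rpow_natCast z 4, ← Real.rpow_mul hz, ← Real.rpow_natCast t 2]
    congr 2
    · field_simp; norm_num
    · push_cast; ring
  have h7 : z ^ (2 * n) ≤ z ^ (8 / (p - 1)) := by
    rw [← Real.rpow_natCast]
    apply Real.rpow_le_rpow_of_exponent_ge hz0 hz1
    push_cast
    have : 8 / (p - 1) = 2 * (4 / (p - 1)) := by ring
    rw [this]; linarith
  have h8 : R ^ (-4 - (8 + 2 * a) / (p - 1)) = R⁻¹ ^ 4 * R ^ (-((8 + 2 * a) / (p - 1))) := by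
    rw [sub_eq_add_neg, Real.rpow_add hR]
    congr 1
    rw [Real.rpow_neg hR.le, inv_pow]; norm_cast
  have h9 : t ^ 2 * z ^ (2 * n) ≤ (ε⁻¹ * 4 ^ a) ^ (2 / (p - 1)) * R ^ (-((8 + 2 * a) / (p - 1))) := by
    refine le_trans ?_ h5
    rw [h6]; gcongr
  have h10 : 0 ≤ ε * (r ^ a * t ^ (p + 1) * z ^ (2 * n + 4)) := by positivity
  calc R⁻¹ ^ 4 * (t ^ 2 * z ^ (2 * n)) ≤ R⁻¹ ^ 4 *
        ((ε⁻¹ * 4 ^ a) ^ (2 / (p - 1)) * R ^ (-((8 + 2 * a) / (p - 1)))) := by gcongr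
    _ = (ε⁻¹ * 4 ^ a) ^ (2 / (p - 1)) * R ^ (-4 - (8 + 2 * a) / (p - 1)) := by rw [h8]; ring
    _ ≤ _ := by linarith

end Cutoff

section Energy
open scoped ContDiff
variable {N : ℕ}

lemma lap_sub {f g : Eu N → ℝ} (hf : ContDiff ℝ 2 f) (hg : ContDiff ℝ 2 g) :
    lap (fun x => f x - g x) = fun x => lap f x - lap g x := by
  ext x
  simp only [lap_eq]
  rw [← Finset.sum_sub_distrib]
  refine Finset.sum_congr rfl fun i _ => ?_
  rw [pd_sub (hf.differentiable (by norm_num)) (hg.differentiable (by norm_num)),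
    pd_sub ((pd_c1 hf i).differentiable (by norm_num)) ((pd_c1 hg i).differentiable (by norm_num))]

lemma gd_sub {u f g : Eu N → ℝ} (hf : Differentiable ℝ f) (hg : Differentiable ℝ g) (x : Eu N) :
    gd u (fun x => f x - g x) x = gd u f x - gd u g x := by
  unfold gd
  rw [← Finset.sum_sub_distrib]
  refine Finset.sum_congr rfl fun i _ => ?_
  rw [pd_sub hf hg]; ring

lemma chi_sub_le {f g : Eu N → ℝ} (hf : Differentiable ℝ f) (hg : Differentiable ℝ g) (x : Eu N) :
    chi (fun x => f x - g x) x ≤ 2 * chi f x + 2 * chi g x := by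
  unfold chi
  rw [Finset.mul_sum, Finset.mul_sum, ← Finset.sum_add_distrib]
  refine Finset.sum_le_sum fun i _ => ?_
  rw [pd_sub hf hg]
  nlinarith [sq_nonneg (pd i f x + pd i g x)]

lemma lemT {C ε u w χ lχ lη η q ρ : ℝ} (hC : 0 ≤ C) (hε : 0 < ε)
    (hρ : 0 ≤ ρ) (h0 : 0 ≤ χ) (h1 : χ ≤ ρ * (C * (η * q))) (h2 : |lχ| ≤ ρ ^ 2 * (C * q ^ 2))
    (h3 : |lη| ≤ ρ * (C * q)) :
    4 * (u ^ 2 * lχ) - 8 * (u * w * χ) + 2 * (u ^ 2 * lη ^ 2) + 2 * (|u * w| * χ) ≤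
      ε * (w ^ 2 * η ^ 2) + (4 * C + 2 * C ^ 2 + 25 * C ^ 2 / ε) * (ρ ^ 2 * (u ^ 2 * q ^ 2)) := by
  have a1 : u ^ 2 * lχ ≤ u ^ 2 * (ρ ^ 2 * (C * q ^ 2)) :=
    mul_le_mul_of_nonneg_left ((le_abs_self _).trans h2) (sq_nonneg u)
  have a2 : lη ^ 2 ≤ (ρ * (C * q)) ^ 2 := by
    rw [← sq_abs lη]; exact pow_le_pow_left₀ (abs_nonneg _) h3 2
  have a3 : u ^ 2 * lη ^ 2 ≤ u ^ 2 * (ρ * (C * q)) ^ 2 := mul_le_mul_of_nonneg_left a2 (sq_nonneg u)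
  have a4 : -(u * w * χ) ≤ |u * w| * χ := by
    rw [← neg_mul]; exact mul_le_mul_of_nonneg_right (neg_le_abs _) h0
  have a5 : |u * w| * χ ≤ |u * w| * (ρ * (C * (η * q))) :=
    mul_le_mul_of_nonneg_left h1 (abs_nonneg _)
  have a6 : 10 * (|u * w| * (ρ * (C * (η * q)))) ≤
      ε * (w ^ 2 * η ^ 2) + (25 * C ^ 2 / ε) * (ρ ^ 2 * (u ^ 2 * q ^ 2)) := by
    have e : ε * (w ^ 2 * η ^ 2) + (25 * C ^ 2 / ε) * (ρ ^ 2 * (u ^ 2 * q ^ 2))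
        - 10 * (|u * w| * (ρ * (C * (η * q))))
        = (ε * (|w| * η) - 5 * C * ρ * |u| * q) ^ 2 / ε := by
      rw [abs_mul, ← sq_abs w, ← sq_abs u]
      field_simp
      ring
    have : 0 ≤ (ε * (|w| * η) - 5 * C * ρ * |u| * q) ^ 2 / ε := by positivity
    linarith
  nlinarith

lemma vol_bound (N : ℕ) (γ c : ℝ) (hc : 0 < c) : ∃ V, 0 ≤ V ∧ ∀ R : ℝ, 0 < R →
    Integrable (Set.indicator (Metric.closedBall (0 : Eu N) (c * R)) (fun _ => R ^ (-4 - γ))) ∧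
    ∫ x, Set.indicator (Metric.closedBall (0 : Eu N) (c * R)) (fun _ => R ^ (-4 - γ)) x
      = V * R ^ ((N : ℝ) - 4 - γ) := by
  refine ⟨c ^ N * (volume (Metric.closedBall (0 : Eu N) 1)).toReal, by positivity, ?_⟩
  intro R hR
  constructor
  · rw [integrable_indicator_iff Metric.isClosed_closedBall.measurableSet]
    exact integrableOn_const (measure_closedBall_lt_top.ne)
  rw [integral_indicator Metric.isClosed_closedBall.measurableSet, setIntegral_const, smul_eq_mul,
    Measure.real, Measure.addHaar_closedBall' _ _ (by positivity : 0 ≤ c * R), ENNReal.toReal_mul,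
    ENNReal.toReal_ofReal (by positivity)]
  have e : (N : ℝ) - 4 - γ = N + (-4 - γ) := by ring
  rw [e, Real.rpow_add hR, Real.rpow_natCast, finrank_euclideanSpace_fin, mul_pow]
  ring

lemma cont_W {a p : ℝ} (ha : 0 ≤ a) {u : Eu N → ℝ} (hu : Continuous u) (hpos : ∀ x, 0 < u x) :
    Continuous (fun x : Eu N => ‖x‖ ^ a * u x ^ (p + 1)) :=
  (continuous_norm.rpow_const fun _ => Or.inr ha).mul
      (hu.rpow_const fun x => Or.inl (hpos x).ne')

/-- Integrand of the error term. -/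
noncomputable def Berr (u η : Eu N → ℝ) (x : Eu N) : ℝ :=
  (2 * gd u η x + u x * lap η x) ^ 2 + 2 * (|u x * lap u x| * chi η x)

lemma Berr_int {u η : Eu N → ℝ} (hu : ContDiff ℝ 4 u) (hη : ContDiff ℝ 4 η)
    (hc : HasCompactSupport η) : Integrable (Berr u η) := by
  have c0 := hu.continuous
  have c1 := lap_cont (hu.of_le (m := 2) (by norm_num))
  have c2 := lap_cont (hη.of_le (m := 2) (by norm_num))
  have c4 := (chi_c3 hη).continuous
  have c5 := gd_cont (hu.of_le (m := 1) (by norm_num)) (hη.of_le (m := 1) (by norm_num))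
  have van := fun x (hx : x ∉ tsupport η) => van_all (ev_zero hx)
  unfold Berr
  exact int_van (by fun_prop) hc fun x hx => by
    simp [(van x hx).2.1, gd_zero (van x hx).1, (van x hx).2.2.1]

lemma Berr_sub {u f g : Eu N → ℝ} (hf : ContDiff ℝ 4 f) (hg : ContDiff ℝ 4 g) (x : Eu N) :
    Berr u (fun x => f x - g x) x ≤ 2 * Berr u f x + 2 * Berr u g x := by
  have df := hf.differentiable (by norm_num)
  have dg := hg.differentiable (by norm_num)
  unfold Berr
  rw [gd_sub df dg, lap_sub (hf.of_le (by norm_num)) (hg.of_le (by norm_num))]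
  have h := mul_le_mul_of_nonneg_left (chi_sub_le df dg x) (abs_nonneg (u x * lap u x))
  simp only
  nlinarith [sq_nonneg ((2 * gd u f x + u x * lap f x) + (2 * gd u g x + u x * lap g x))]

/-- Combination of `lemB` with the error term. -/
lemma Berr_le {u η : Eu N → ℝ} (hu : ContDiff ℝ 4 u) (hη : ContDiff ℝ 4 η)
    (hc : HasCompactSupport η) :
    Integrable (fun x => 4 * (u x ^ 2 * lap (chi η) x) - 8 * (u x * lap u x * chi η x)
        + 2 * (u x ^ 2 * (lap η x) ^ 2) + 2 * (|u x * lap u x| * chi η x)) ∧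
    ∫ x, Berr u η x ≤
      ∫ x, (4 * (u x ^ 2 * lap (chi η) x) - 8 * (u x * lap u x * chi η x)
        + 2 * (u x ^ 2 * (lap η x) ^ 2) + 2 * (|u x * lap u x| * chi η x)) := by
  have c0 := hu.continuous
  have c1 := lap_cont (hu.of_le (m := 2) (by norm_num))
  have c2 := lap_cont (hη.of_le (m := 2) (by norm_num))
  have c3 := lap_cont ((chi_c3 hη).of_le (m := 2) (by norm_num))
  have c4 := (chi_c3 hη).continuous
  have c5 := gd_cont (hu.of_le (m := 1) (by norm_num)) (hη.of_le (m := 1) (by norm_num))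
  have van := fun x (hx : x ∉ tsupport η) => van_all (ev_zero hx)
  have i1 : Integrable (fun x => 4 * (u x ^ 2 * lap (chi η) x) - 8 * (u x * lap u x * chi η x)
        + 2 * (u x ^ 2 * (lap η x) ^ 2)) :=
    int_van (by fun_prop) hc fun x hx => by
      simp [(van x hx).2.1, (van x hx).2.2.1, (van x hx).2.2.2]
  have i2 : Integrable (fun x => 2 * (|u x * lap u x| * chi η x)) :=
    int_van (by fun_prop) hc fun x hx => by simp [(van x hx).2.2.1]
  have i3 : Integrable (fun x => (2 * gd u η x + u x * lap η x) ^ 2) :=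
    int_van (by fun_prop) hc fun x hx => by simp [(van x hx).2.1, gd_zero (van x hx).1]
  refine ⟨i1.add i2, ?_⟩
  have I1 := integral_add i1 i2
  have I2 := integral_add i3 i2
  unfold Berr
  rw [I1, I2]
  linarith [lemB hu hη hc]

theorem energy_finite (N : ℕ) {a p : ℝ} (ha : 0 ≤ a) (hp : 1 < p)
    (hneg : (N : ℝ) - 4 - (8 + 2 * a) / (p - 1) < 0)
    {u : Eu N → ℝ} (hu : ContDiff ℝ 4 u) (hpos : ∀ x, 0 < u x)
    (heq : ∀ x, lap (lap u) x = ‖x‖ ^ a * u x ^ p)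
    {K : Set (Eu N)} (hK : IsCompact K)
    (hst : ∀ φ : Eu N → ℝ, ContDiff ℝ 4 φ → HasCompactSupport φ → Disjoint (tsupport φ) K →
            0 ≤ (∫ x, (lap φ x) ^ 2) - p * ∫ x, ‖x‖ ^ a * u x ^ (p - 1) * φ x ^ 2) :
    Integrable (fun x => (lap u x) ^ 2 + ‖x‖ ^ a * u x ^ (p + 1)) := by
  obtain ⟨ζ, hζ, z0, z1, zone, ztwo⟩ := exists_zeta N
  obtain ⟨R0, hR0, hKR⟩ := hK.isBounded.subset_ball_lt 1 (0 : Eu N)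
  have hR0' : 0 < R0 := by linarith
  set n := ⌈4 / (p - 1)⌉₊ with hn
  have hn' : 4 / (p - 1) ≤ n := Nat.le_ceil _
  set η0 : Eu N → ℝ := fun x => ζ x ^ (n + 2) with hη0
  have η0s : ContDiff ℝ ∞ η0 := hζ.pow _
  have η04 := smooth4 η0s
  have η0two : ∀ y, 2 ≤ ‖y‖ → η0 y = 0 := fun y hy => by simp [hη0, ztwo y hy]
  have η0one : ∀ y, ‖y‖ ≤ 1 → η0 y = 1 := fun y hy => by simp [hη0, zone y hy]
  obtain ⟨C, hC, hCb⟩ := cutoff_pow hζ z0 ztwo n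
  set F : Eu N → ℝ := fun x => (lap u x) ^ 2 + ‖x‖ ^ a * u x ^ (p + 1) with hF
  have cW := cont_W (p := p) ha hu.continuous hpos
  have cF : Continuous F := ((lap_cont (hu.of_le (by norm_num))).pow 2).add cW
  have F0 : ∀ x, 0 ≤ F x := fun x => by
    have := (hpos x).le
    simp only [hF]; positivity
  set ρ := sc R0 ζ with hρ
  have ρ4 : ContDiff ℝ 4 ρ := sc_contDiff (smooth4 hζ) R0
  have ρc : HasCompactSupport ρ := sc_hcs (hcs_of_zero ztwo) hR0'
  have iρ : Integrable (fun x => F x * ρ x ^ 2) := by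
    have := ρ4.continuous
    exact int_van (by fun_prop) ρc fun x hx => by simp [(ev_zero hx).eq_of_nhds]
  set C1 := 3 * (p / (p - 1)) + 2 with hC1
  have hp1 : 0 < p - 1 := by linarith
  have C1pos : 0 < C1 := by positivity
  set C0 := 2 * (∫ x, F x * ρ x ^ 2) + 4 * C1 * ∫ x, Berr u ρ x with hC0
  set ε := 1 / (8 * C1) with hε
  have εpos : 0 < ε := by positivity
  set C2 := 4 * C + 2 * C ^ 2 + 25 * C ^ 2 / ε with hC2
  have C2n : 0 ≤ C2 := by positivity
  obtain ⟨C3, hC3, hY⟩ := lemY ha hp hn' (ε := ε / (C2 + 1)) (by positivity)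
  obtain ⟨V, hV, hVb⟩ := vol_bound N ((8 + 2 * a) / (p - 1)) 2 (by norm_num)
  set γ := (8 + 2 * a) / (p - 1) with hγ
  have main : ∀ R, R0 ≤ R → ∫ x in Metric.closedBall (0 : Eu N) R, ‖F x‖ ≤
      2 * C0 + 8 * C1 * (C2 * C3 * V) := by
    intro R hR
    have hRp : 0 < R := by linarith
    set ηR := sc R η0 with hηR
    have η4 : ContDiff ℝ 4 ηR := sc_contDiff η04 R
    have ηc : HasCompactSupport ηR := sc_hcs (hcs_of_zero η0two) hRp
    have nsc : ∀ x : Eu N, ‖R⁻¹ • x‖ = ‖x‖ / R := fun x => by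
      rw [norm_smul, norm_inv, Real.norm_of_nonneg hRp.le]; ring
    have ηone : ∀ x : Eu N, ‖x‖ ≤ R → ηR x = 1 := fun x hx => by
      apply η0one; rw [nsc]; exact (div_le_one hRp).2 hx
    have ρone : ∀ x : Eu N, ‖x‖ ≤ R0 → ρ x = 1 := fun x hx => by
      apply zone
      rw [norm_smul, norm_inv, Real.norm_of_nonneg hR0'.le, inv_mul_eq_div]
      exact (div_le_one hR0').2 hx
    set η : Eu N → ℝ := fun x => ηR x - ρ x with hη
    have hη4 : ContDiff ℝ 4 η := η4.sub ρ4
    have hηc : HasCompactSupport η := ηc.sub ρc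
    have hstη := hst (fun x => u x * η x) (hu.mul hη4) hηc.mul_left (by
      rw [Set.disjoint_left]
      intro x hx hxK
      have hxb := hKR hxK
      rw [mem_ball_zero_iff] at hxb
      have : η =ᶠ[nhds x] fun _ => 0 := ev_of_lt (r := R0) (fun y hy => by
        simp [hη, ηone y (hy.trans hR), ρone y hy]) hxb
      have h2 : (fun x => u x * η x) =ᶠ[nhds x] 0 := by
        filter_upwards [this] with y hy
        simp [hy]
      exact (notMem_tsupport_iff_eventuallyEq.2 h2) hx)
    have S := lemS ha hp hu hpos heq hη4 hηc hstη
    have cη := hη4.continuous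
    have cηR := η4.continuous
    have iη : Integrable (fun x => F x * η x ^ 2) :=
      int_van (by fun_prop) hηc fun x hx => by simp [(ev_zero hx).eq_of_nhds]
    have iηR : Integrable (fun x => F x * ηR x ^ 2) :=
      int_van (by fun_prop) ηc fun x hx => by simp [(ev_zero hx).eq_of_nhds]
    have s1 : ∫ x, F x * ηR x ^ 2 ≤ 2 * (∫ x, F x * η x ^ 2) + 2 * ∫ x, F x * ρ x ^ 2 := by
      rw [← integral_const_mul, ← integral_const_mul,
        ← integral_add (iη.const_mul 2) (iρ.const_mul 2)]
      refine integral_mono iηR ((iη.const_mul 2).add (iρ.const_mul 2)) fun x => ?_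
      simp only [hη]
      nlinarith [mul_nonneg (F0 x) (sq_nonneg (ηR x - 2 * ρ x))]
    have s2 : ∫ x, F x * η x ^ 2 ≤ C1 * ∫ x, Berr u η x := S
    have s3 : ∫ x, Berr u η x ≤ 2 * (∫ x, Berr u ηR x) + 2 * ∫ x, Berr u ρ x := by
      have j1 := Berr_int hu η4 ηc
      have j2 := Berr_int hu ρ4 ρc
      rw [← integral_const_mul, ← integral_const_mul,
        ← integral_add (j1.const_mul 2) (j2.const_mul 2)]
      exact integral_mono (Berr_int hu hη4 hηc) ((j1.const_mul 2).add (j2.const_mul 2)) fun x =>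
        Berr_sub η4 ρ4 x
    obtain ⟨iT, s4⟩ := Berr_le hu η4 ηc
    obtain ⟨iV, eV⟩ := hVb R hRp
    have s5 : ∫ x, (4 * (u x ^ 2 * lap (chi ηR) x) - 8 * (u x * lap u x * chi ηR x)
        + 2 * (u x ^ 2 * (lap ηR x) ^ 2) + 2 * (|u x * lap u x| * chi ηR x)) ≤
        ε * (∫ x, F x * ηR x ^ 2) + C2 * C3 * (V * R ^ ((N : ℝ) - 4 - γ)) := by
      rw [← eV, ← integral_const_mul, ← integral_const_mul,
        ← integral_add (iηR.const_mul ε) (iV.const_mul (C2 * C3))]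
      refine integral_mono iT ((iηR.const_mul ε).add (iV.const_mul (C2 * C3))) fun x => ?_
      simp only
      have g0 : 0 ≤ ε * (F x * ηR x ^ 2) := mul_nonneg εpos.le (mul_nonneg (F0 x) (sq_nonneg _))
      have g1 : 0 ≤ C2 * C3 * Set.indicator (Metric.closedBall (0 : Eu N) (2 * R))
          (fun _ => R ^ (-4 - γ)) x := by
        refine mul_nonneg (by positivity) (Set.indicator_nonneg (fun _ _ => by positivity) x)
      have zer : (∃ c, η0 =ᶠ[nhds (R⁻¹ • x)] fun _ => c) →
          4 * (u x ^ 2 * lap (chi ηR) x) - 8 * (u x * lap u x * chi ηR x)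
        + 2 * (u x ^ 2 * (lap ηR x) ^ 2) + 2 * (|u x * lap u x| * chi ηR x) = 0 := by
        rintro ⟨c, hc⟩
        obtain ⟨_, v2, v3, v4⟩ := van_all hc
        rw [hηR, lap_chi_sc R η04, chi_sc, lap_sc R (η04.of_le (by norm_num))]
        simp [sc, v2, v3, v4]
      by_cases hx1 : ‖x‖ < R
      · rw [zer ⟨1, ev_of_lt η0one (by rw [nsc]; exact (div_lt_one hRp).2 hx1)⟩]
        linarith
      by_cases hx2 : 2 * R < ‖x‖
      · rw [zer ⟨0, ev_of_gt η0two (by rw [nsc]; exact (lt_div_iff₀ hRp).2 hx2)⟩]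
        linarith
      push Not at hx1 hx2
      rw [Set.indicator_of_mem (by simpa using hx2)]
      obtain ⟨b1, b2, b3⟩ := hCb (R⁻¹ • x)
      set z := ζ (R⁻¹ • x) with hz
      have hηx : ηR x = z ^ (n + 2) := rfl
      have T := lemT (C := C) (ε := ε) (u := u x) (w := lap u x) (χ := chi ηR x)
        (lχ := lap (chi ηR) x) (lη := lap ηR x) (η := ηR x) (q := z ^ n) (ρ := R⁻¹ ^ 2)
        hC εpos (by positivity) (chi_nonneg _ _)
        (by rw [hηR, chi_sc]; exact mul_le_mul_of_nonneg_left b1 (by positivity))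
        (by
          rw [hηR, lap_chi_sc R η04, abs_mul, abs_of_nonneg (by positivity : 0 ≤ R⁻¹ ^ 4), ← pow_mul]
          exact mul_le_mul_of_nonneg_left b2 (by positivity))
        (by
          rw [hηR, lap_sc R (η04.of_le (by norm_num)), abs_mul,
            abs_of_nonneg (by positivity : 0 ≤ R⁻¹ ^ 2)]
          exact mul_le_mul_of_nonneg_left b3 (by positivity))
      refine T.trans ?_
      have y := hY R ‖x‖ (u x) z hRp (by linarith) (hpos x) (z0 _) (z1 _)
      have y1 : C2 * ((R⁻¹ ^ 2) ^ 2 * (u x ^ 2 * (z ^ n) ^ 2)) ≤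
          ε * (‖x‖ ^ a * u x ^ (p + 1) * ηR x ^ 2) + C2 * C3 * R ^ (-4 - γ) := by
        have hW : 0 ≤ ‖x‖ ^ a * u x ^ (p + 1) * z ^ (2 * n + 4) := by
          have := (hpos x).le
          have := z0 (R⁻¹ • x)
          positivity
        have e1 : (R⁻¹ ^ 2) ^ 2 * (u x ^ 2 * (z ^ n) ^ 2) = R⁻¹ ^ 4 * (u x ^ 2 * z ^ (2 * n)) := by
          ring
        have e2 : ηR x ^ 2 = z ^ (2 * n + 4) := by rw [hηx]; ring
        rw [e1, e2]
        calc _ ≤ C2 * (ε / (C2 + 1) * (‖x‖ ^ a * u x ^ (p + 1) * z ^ (2 * n + 4))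
              + C3 * R ^ (-4 - γ)) := mul_le_mul_of_nonneg_left y C2n
          _ = (C2 / (C2 + 1)) * (ε * (‖x‖ ^ a * u x ^ (p + 1) * z ^ (2 * n + 4)))
              + C2 * C3 * R ^ (-4 - γ) := by ring
          _ ≤ 1 * (ε * (‖x‖ ^ a * u x ^ (p + 1) * z ^ (2 * n + 4))) + C2 * C3 * R ^ (-4 - γ) := by
              gcongr
              rw [div_le_one (by positivity)]; linarith
          _ = _ := by ring
      have e3 : ε * (F x * ηR x ^ 2) = ε * (lap u x ^ 2 * ηR x ^ 2)
          + ε * (‖x‖ ^ a * u x ^ (p + 1) * ηR x ^ 2) := by simp only [hF]; ring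
      linarith
    have s6 : R ^ ((N : ℝ) - 4 - γ) ≤ 1 :=
      Real.rpow_le_one_of_one_le_of_nonpos (by linarith) hneg.le
    have s7 : C2 * C3 * (V * R ^ ((N : ℝ) - 4 - γ)) ≤ C2 * C3 * V := by
      have : V * R ^ ((N : ℝ) - 4 - γ) ≤ V * 1 := mul_le_mul_of_nonneg_left s6 hV
      calc _ ≤ C2 * C3 * (V * 1) := mul_le_mul_of_nonneg_left this (by positivity)
        _ = _ := by ring
    have s8 : ∫ x in Metric.closedBall (0 : Eu N) R, ‖F x‖ ≤ ∫ x, F x * ηR x ^ 2 := by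
      rw [← integral_indicator Metric.isClosed_closedBall.measurableSet]
      refine integral_mono ?_ iηR fun x => ?_
      · rw [integrable_indicator_iff Metric.isClosed_closedBall.measurableSet]
        exact (cF.norm.continuousOn).integrableOn_compact (isCompact_closedBall _ _)
      · by_cases hx : x ∈ Metric.closedBall (0 : Eu N) R
        · rw [Set.indicator_of_mem hx]
          simp only
          rw [ηone x (by simpa using hx), Real.norm_of_nonneg (F0 x)]; simp
        · rw [Set.indicator_of_notMem hx]
          exact mul_nonneg (F0 x) (sq_nonneg _)
    have hεC : C1 * ε = 1 / 8 := by rw [hε]; field_simp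
    set I := ∫ x, F x * ηR x ^ 2 with hI
    have t1 : C1 * (∫ x, Berr u ηR x) ≤ C1 * (ε * I + C2 * C3 * V) :=
      mul_le_mul_of_nonneg_left (s4.trans (s5.trans (by linarith))) C1pos.le
    have t2 : C1 * ∫ x, Berr u η x ≤ C1 * (2 * (∫ x, Berr u ηR x) + 2 * ∫ x, Berr u ρ x) :=
      mul_le_mul_of_nonneg_left s3 C1pos.le
    have t3 : C1 * (ε * I + C2 * C3 * V) = 1 / 8 * I + C1 * (C2 * C3 * V) := by
      rw [← hεC]; ring
    have t4 : I ≤ C0 + 4 * (C1 * (∫ x, Berr u ηR x)) := by rw [hC0]; linarith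
    linarith
  refine (aecover_closedBall (x := (0 : Eu N)) (r := fun R : ℝ => R) (l := Filter.atTop)
    Filter.tendsto_id).integrable_of_integral_norm_bounded _ ?_
    (Filter.eventually_atTop.2 ⟨R0, main⟩)
  intro R
  exact (cF.continuousOn).integrableOn_compact (isCompact_closedBall _ _)

end Energy

section Annulus
open scoped ContDiff
variable {N : ℕ}

lemma int_sq {f : Eu N → ℝ} (hf : Continuous f) (hc : HasCompactSupport f) :
    Integrable (fun x => f x ^ 2) := by
  have h : HasCompactSupport (fun x => f x * f x) := hc.mul_right
  have : Integrable (fun x => f x * f x) := int_cc (hf.mul hf) h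
  simpa only [sq] using this

lemma grad_eq {v : Eu N → ℝ} (hv : ContDiff ℝ 2 v) (hc : HasCompactSupport v) :
    ∫ x, ∑ i, (pd i v x) ^ 2 = - ∫ x, v x * lap v x := by
  have hv1 : ContDiff ℝ 1 v := hv.of_le (by norm_num)
  have hi : ∀ i : Fin N, Integrable (fun x => (pd i v x) ^ 2) := fun i =>
    int_sq (pd_cont hv1 i) (pd_hcs hc i)
  have hj : ∀ i : Fin N, Integrable (fun x => v x * pd i (pd i v) x) := fun i =>
    int_cc (hv.continuous.mul (pd_cont (pd_c1 hv i) i)) hc.mul_right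
  rw [integral_finsetSum _ fun i _ => hi i]
  have : ∀ x, v x * lap v x = ∑ i, v x * pd i (pd i v) x := fun x => by
    rw [lap_eq, Finset.mul_sum]
  simp_rw [this]
  rw [integral_finsetSum _ fun i _ => hj i, ← Finset.sum_neg_distrib]
  refine Finset.sum_congr rfl fun i _ => ?_
  rw [ibp hv1 (pd_c1 hv i) (pd_hcs hc i) i, neg_neg]
  simp only [sq]

noncomputable def Gq (R : ℝ) (v : Eu N → ℝ) (x : Eu N) : ℝ :=
  (lap v x) ^ 2 + R⁻¹ ^ 4 * v x ^ 2 + R⁻¹ ^ 2 * (∑ i, (pd i v x) ^ 2)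
    + ∑ i, ∑ j, (pd i (pd j v) x) ^ 2

set_option maxHeartbeats 1600000 in
lemma Gq_int {v : Eu N → ℝ} (hv : ContDiff ℝ 4 v) (hc : HasCompactSupport v) {R : ℝ} (hR : 0 < R) :
    Integrable (Gq R v) ∧
    ∫ x, Gq R v x ≤ 3 * (∫ x, (lap v x) ^ 2) + 2 * ∫ x, R⁻¹ ^ 4 * v x ^ 2 := by
  have hv2 : ContDiff ℝ 2 v := hv.of_le (by norm_num)
  have hv1 : ContDiff ℝ 1 v := hv.of_le (by norm_num)
  have i1 : Integrable (fun x => (lap v x) ^ 2) :=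
    int_sq (lap_cont hv2) (lap_hcs hc)
  have i2 : Integrable (fun x => R⁻¹ ^ 4 * v x ^ 2) :=
    (int_sq hv.continuous hc).const_mul _
  have i3 : Integrable (fun x => R⁻¹ ^ 2 * ∑ i, (pd i v x) ^ 2) := by
    refine (integrable_finsetSum _ fun i _ => ?_).const_mul _
    exact int_sq (pd_cont hv1 i) (pd_hcs hc i)
  have i4 : Integrable (fun x => ∑ i, ∑ j, (pd i (pd j v) x) ^ 2) := by
    refine integrable_finsetSum _ fun i _ => integrable_finsetSum _ fun j _ => ?_
    exact int_sq (pd_cont (pd_c1 hv2 j) i) (pd_hcs (pd_hcs hc j) i)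
  have i12 : Integrable (fun x => (lap v x) ^ 2 + R⁻¹ ^ 4 * v x ^ 2) := i1.add i2
  have i123 : Integrable (fun x => (lap v x) ^ 2 + R⁻¹ ^ 4 * v x ^ 2
    + R⁻¹ ^ 2 * ∑ i, (pd i v x) ^ 2) := i12.add i3
  refine ⟨i123.add i4, ?_⟩
  unfold Gq
  rw [integral_add i123 i4, integral_add i12 i3, integral_add i1 i2, hess_eq hv hc]
  have : ∫ x, R⁻¹ ^ 2 * ∑ i, (pd i v x) ^ 2 ≤
      (∫ x, (lap v x) ^ 2) + ∫ x, R⁻¹ ^ 4 * v x ^ 2 := by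
    rw [integral_const_mul, grad_eq hv2 hc, ← integral_neg, ← integral_const_mul,
      ← integral_add i1 i2]
    refine integral_mono ?_ i12 fun x => ?_
    · exact ((int_cc (hv.continuous.mul (lap_cont hv2)) hc.mul_right).neg).const_mul _
    · simp only
      nlinarith [sq_nonneg (lap v x + R⁻¹ ^ 2 * v x), sq_nonneg (lap v x),
        sq_nonneg (R⁻¹ ^ 2 * v x)]
  linarith

lemma exists_kappa (N : ℕ) : ∃ κ : Eu N → ℝ, ContDiff ℝ ∞ κ ∧ (∀ y, κ y ^ 2 ≤ 1) ∧
    (∀ y, 1 / 2 ≤ ‖y‖ → ‖y‖ ≤ 4 → κ y = 1) ∧ (∀ y, ‖y‖ ≤ 1 / 4 → κ y = 0) ∧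
    (∀ y, 8 ≤ ‖y‖ → κ y = 0) ∧
    ∃ C, 0 ≤ C ∧ ∀ y, chi κ y ≤ C ∧ |lap (chi κ) y| ≤ C ∧ |lap κ y| ≤ C := by
  obtain ⟨ζ, hζ, z0, z1, zone, ztwo⟩ := exists_zeta N
  have n1 : ∀ y : Eu N, ‖(4 : ℝ)⁻¹ • y‖ = ‖y‖ / 4 := fun y => by
    rw [norm_smul]; norm_num; ring
  have n2 : ∀ y : Eu N, ‖((1 / 4 : ℝ))⁻¹ • y‖ = 4 * ‖y‖ := fun y => by
    rw [norm_smul]; norm_num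
  set κ : Eu N → ℝ := fun y => sc 4 ζ y - sc (1 / 4) ζ y with hκ
  have hs : ContDiff ℝ ∞ κ := (sc_contDiff hζ 4).sub (sc_contDiff hζ (1 / 4))
  have k0 : ∀ y, ‖y‖ ≤ 1 / 4 → κ y = 0 := fun y hy => by
    simp only [hκ, sc]
    rw [zone _ (by rw [n1]; linarith), zone _ (by rw [n2]; linarith)]; ring
  have k8 : ∀ y, 8 ≤ ‖y‖ → κ y = 0 := fun y hy => by
    simp only [hκ, sc]
    rw [ztwo _ (by rw [n1]; linarith), ztwo _ (by rw [n2]; linarith)]; ring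
  have h4 := smooth4 hs
  obtain ⟨A, hA, bA⟩ := bdd_ball ((chi_c3 h4).continuous) 8
  obtain ⟨B, hB, bB⟩ := bdd_ball (lap_cont ((chi_c3 h4).of_le (by norm_num))) 8
  obtain ⟨D, hD, bD⟩ := bdd_ball (lap_cont (h4.of_le (by norm_num))) 8
  refine ⟨κ, hs, fun y => ?_, fun y h1 h2 => ?_, k0, k8, A + B + D, by positivity, fun y => ?_⟩
  · have a1 := z0 ((4 : ℝ)⁻¹ • y)
    have a2 := z1 ((4 : ℝ)⁻¹ • y)
    have a3 := z0 ((1 / 4 : ℝ)⁻¹ • y)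
    have a4 := z1 ((1 / 4 : ℝ)⁻¹ • y)
    simp only [hκ, sc]
    rw [sq_le_one_iff_abs_le_one, abs_le]
    constructor <;> linarith
  · simp only [hκ, sc]
    rw [zone _ (by rw [n1]; linarith), ztwo _ (by rw [n2]; linarith)]; ring
  · by_cases hy : ‖y‖ ≤ 8
    · have := bA y hy
      have := bB y hy
      have := bD y hy
      have := le_abs_self (chi κ y)
      exact ⟨by linarith, by linarith, by linarith⟩
    · obtain ⟨_, v2, v3, v4⟩ := van_all (ev_of_gt k8 (not_le.1 hy))
      rw [v2, v3, v4, abs_zero]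
      exact ⟨by positivity, by positivity, by positivity⟩

noncomputable def tailI (F : Eu N → ℝ) (R : ℝ) : Eu N → ℝ :=
  Set.indicator {x | R / 4 ≤ ‖x‖} F

lemma tail_meas (R : ℝ) : MeasurableSet {x : Eu N | R / 4 ≤ ‖x‖} :=
  (isClosed_le continuous_const continuous_norm).measurableSet

lemma tail_tendsto {F : Eu N → ℝ} (hF : Integrable F) :
    Filter.Tendsto (fun R => ∫ x, tailI F R x) Filter.atTop (nhds 0) := by
  have := tendsto_integral_filter_of_dominated_convergence (μ := volume) (l := Filter.atTop)
    (F := fun R => tailI F R) (f := fun _ => (0 : ℝ)) (fun x => ‖F x‖)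
    (Filter.Eventually.of_forall fun R => (hF.indicator (tail_meas R)).aestronglyMeasurable)
    (Filter.Eventually.of_forall fun R => Filter.Eventually.of_forall fun x =>
      norm_indicator_le_norm_self _ _)
    hF.norm
    (Filter.Eventually.of_forall fun x => by
      refine Filter.Tendsto.congr' (f₁ := fun _ => (0 : ℝ)) ?_ tendsto_const_nhds
      filter_upwards [Filter.eventually_gt_atTop (4 * ‖x‖)] with R hR
      rw [tailI, Set.indicator_of_notMem]
      simp only [Set.mem_ofPred_eq, not_le]; linarith)
  simpa using this

set_option maxHeartbeats 3200000 in
theorem annulus (N : ℕ) {a p : ℝ} (ha : 0 ≤ a) (hp : 1 < p)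
    (hneg : (N : ℝ) - 4 - (8 + 2 * a) / (p - 1) < 0)
    {u : Eu N → ℝ} (hu : ContDiff ℝ 4 u) (hpos : ∀ x, 0 < u x)
    {F : Eu N → ℝ} (hF : F = fun x => (lap u x) ^ 2 + ‖x‖ ^ a * u x ^ (p + 1))
    (iF : Integrable F) :
    ∃ e : ℝ → ℝ, Filter.Tendsto e Filter.atTop (nhds 0) ∧ ∀ R, 0 < R → ∃ v : Eu N → ℝ,
      ContDiff ℝ 4 v ∧ HasCompactSupport v ∧
      (∀ x, R ≤ ‖x‖ → ‖x‖ ≤ 2 * R → u =ᶠ[nhds x] v) ∧ Integrable (tailI F R) ∧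
      Integrable (Gq R v) ∧ (∫ x, tailI F R x) + ∫ x, Gq R v x ≤ e R := by
  obtain ⟨κ, hκ, ksq, kone, k0, k8, C, hC, hCb⟩ := exists_kappa N
  have h4 := smooth4 hκ
  set C2 := 4 * C + 2 * C ^ 2 + 25 * C ^ 2 / 1 with hC2
  have C2n : 0 ≤ C2 := by positivity
  set n := ⌈4 / (p - 1)⌉₊ with hn
  obtain ⟨C3, hC3, hY⟩ := lemY ha hp (Nat.le_ceil (4 / (p - 1))) (ε := 1) (by positivity)
  obtain ⟨V, hV, hVb⟩ := vol_bound N ((8 + 2 * a) / (p - 1)) 8 (by norm_num)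
  set γ := (8 + 2 * a) / (p - 1) with hγ
  have F0 : ∀ x, 0 ≤ F x := fun x => by
    have := (hpos x).le
    simp only [hF]; positivity
  set J : ℝ → ℝ := fun R => (∫ x, tailI F R x) + C3 * (V * R ^ ((N : ℝ) - 4 - γ)) with hJ
  refine ⟨fun R => (20 + 10 * C2) * J R, ?_, fun R hR => ?_⟩
  · have t1 : Filter.Tendsto (fun R : ℝ => R ^ ((N : ℝ) - 4 - γ)) Filter.atTop (nhds 0) := by
      have := tendsto_rpow_neg_atTop (y := -((N : ℝ) - 4 - γ)) (by linarith)
      simpa using this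
    have := ((tail_tendsto iF).add ((t1.const_mul V).const_mul C3)).const_mul (20 + 10 * C2)
    simpa [hJ] using this
  set kR := sc R κ with hkR
  have nsc : ∀ x : Eu N, ‖R⁻¹ • x‖ = ‖x‖ / R := fun x => by
    rw [norm_smul, norm_inv, Real.norm_of_nonneg hR.le]; ring
  have kR4 : ContDiff ℝ 4 kR := sc_contDiff h4 R
  have kRc : HasCompactSupport kR := sc_hcs (hcs_of_zero k8) hR
  set v : Eu N → ℝ := fun x => u x * kR x with hv
  have v4 : ContDiff ℝ 4 v := hu.mul kR4
  have vc : HasCompactSupport v := kRc.mul_left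
  obtain ⟨iG, hG⟩ := Gq_int v4 vc hR
  have it : Integrable (tailI F R) := iF.indicator (tail_meas R)
  obtain ⟨iV, eV⟩ := hVb R hR
  set Jx : Eu N → ℝ := fun x => tailI F R x + C3 * Set.indicator
    (Metric.closedBall (0 : Eu N) (8 * R)) (fun _ => R ^ (-4 - γ)) x with hJx
  have iJx : Integrable Jx := it.add (iV.const_mul C3)
  have eJ : ∫ x, Jx x = J R := by
    simp only [hJx]
    rw [integral_add it (iV.const_mul C3), integral_const_mul, eV]
  have Jx0 : ∀ x, tailI F R x ≤ Jx x := fun x => by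
    simp only [hJx]
    have := mul_nonneg hC3 (Set.indicator_nonneg (s := Metric.closedBall (0 : Eu N) (8 * R))
      (f := fun _ => R ^ (-4 - γ)) (fun _ _ => by positivity) x)
    linarith
  have t0 : ∀ x, 0 ≤ tailI F R x := fun x => Set.indicator_nonneg (fun x _ => F0 x) x
  -- on the annulus
  have key : ∀ x : Eu N, R / 4 ≤ ‖x‖ → ‖x‖ ≤ 8 * R →
      lap u x ^ 2 + R⁻¹ ^ 4 * u x ^ 2 ≤ Jx x := fun x h1 h2 => by
    simp only [hJx, tailI]
    rw [Set.indicator_of_mem (by simpa using h1), Set.indicator_of_mem (by simpa using h2)]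
    have y := hY R ‖x‖ (u x) 1 hR h1 (hpos x) zero_le_one le_rfl
    simp only [one_pow, mul_one, one_mul] at y
    simp only [hF]
    linarith
  have ks : ∀ x, kR x ^ 2 ≤ 1 := fun x => ksq _
  have T1 : ∫ x, R⁻¹ ^ 4 * v x ^ 2 ≤ J R := by
    rw [← eJ]
    refine integral_mono ((int_sq v4.continuous vc).const_mul _) iJx fun x => ?_
    simp only [hv]
    by_cases h1 : R / 4 ≤ ‖x‖
    · by_cases h2 : ‖x‖ ≤ 8 * R
      · refine le_trans ?_ (key x h1 h2)
        have : R⁻¹ ^ 4 * (u x * kR x) ^ 2 ≤ R⁻¹ ^ 4 * u x ^ 2 := by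
          rw [mul_pow]
          have : u x ^ 2 * kR x ^ 2 ≤ u x ^ 2 * 1 := mul_le_mul_of_nonneg_left (ks x) (sq_nonneg _)
          gcongr; linarith
        nlinarith [sq_nonneg (lap u x)]
      · have : kR x = 0 := k8 _ (by rw [nsc, le_div_iff₀ hR]; linarith)
        rw [this]; simpa using (t0 x).trans (Jx0 x)
    · have : kR x = 0 := k0 _ (by rw [nsc, div_le_iff₀ hR]; linarith)
      rw [this]; simpa using (t0 x).trans (Jx0 x)
  have T2 : ∫ x, Berr u kR x ≤ (1 + C2) * J R := by
    obtain ⟨iT, s4⟩ := Berr_le hu kR4 kRc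
    refine s4.trans ?_
    rw [← eJ, ← integral_const_mul]
    refine integral_mono iT (iJx.const_mul _) fun x => ?_
    simp only
    have g0 : 0 ≤ (1 + C2) * Jx x := mul_nonneg (by positivity) ((t0 x).trans (Jx0 x))
    have zer : (κ =ᶠ[nhds (R⁻¹ • x)] fun _ => 0) →
        4 * (u x ^ 2 * lap (chi kR) x) - 8 * (u x * lap u x * chi kR x)
      + 2 * (u x ^ 2 * (lap kR x) ^ 2) + 2 * (|u x * lap u x| * chi kR x) = 0 := by
      intro hc
      obtain ⟨_, v2, v3, v4⟩ := van_all hc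
      rw [hkR, lap_chi_sc R h4, chi_sc, lap_sc R (h4.of_le (by norm_num))]
      simp [sc, v2, v3, v4]
    by_cases hx1 : ‖x‖ < R / 4
    · rwa [zer (ev_of_lt k0 (by rw [nsc, div_lt_iff₀ hR]; linarith))]
    by_cases hx2 : 8 * R < ‖x‖
    · rwa [zer (ev_of_gt k8 (by rw [nsc]; exact (lt_div_iff₀ hR).2 hx2))]
    push Not at hx1 hx2
    obtain ⟨b1, b2, b3⟩ := hCb (R⁻¹ • x)
    have T := lemT (C := C) (ε := 1) (u := u x) (w := lap u x) (χ := chi kR x)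
      (lχ := lap (chi kR) x) (lη := lap kR x) (η := 1) (q := 1) (ρ := R⁻¹ ^ 2)
      hC one_pos (by positivity) (chi_nonneg _ _)
      (by rw [hkR, chi_sc, mul_one, mul_one]; exact mul_le_mul_of_nonneg_left b1 (by positivity))
      (by
        rw [hkR, lap_chi_sc R h4, abs_mul, abs_of_nonneg (by positivity : 0 ≤ R⁻¹ ^ 4), ← pow_mul,
          one_pow, mul_one]
        exact mul_le_mul_of_nonneg_left b2 (by positivity))
      (by
        rw [hkR, lap_sc R (h4.of_le (by norm_num)), abs_mul,
          abs_of_nonneg (by positivity : 0 ≤ R⁻¹ ^ 2), mul_one]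
        exact mul_le_mul_of_nonneg_left b3 (by positivity))
    refine T.trans ?_
    have k := key x hx1 hx2
    have e1 : (R⁻¹ ^ 2) ^ 2 * (u x ^ 2 * 1 ^ 2) = R⁻¹ ^ 4 * u x ^ 2 := by ring
    rw [← hC2, e1]
    have A0 : 0 ≤ R⁻¹ ^ 4 * u x ^ 2 := by positivity
    nlinarith [sq_nonneg (lap u x), mul_nonneg C2n (sq_nonneg (lap u x)),
      mul_le_mul_of_nonneg_left k (by positivity : 0 ≤ 1 + C2)]
  have T3 : ∫ x, (lap v x) ^ 2 ≤ 2 * J R + 2 * ((1 + C2) * J R) := by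
    have : ∫ x, (lap v x) ^ 2 ≤ ∫ x, (2 * Jx x + 2 * Berr u kR x) := by
      refine integral_mono (int_sq (lap_cont (v4.of_le (by norm_num))) (lap_hcs vc))
        ((iJx.const_mul 2).add ((Berr_int hu kR4 kRc).const_mul 2)) fun x => ?_
      simp only
      rw [hv, lap_mul (hu.of_le (by norm_num)) (kR4.of_le (by norm_num))]
      have hw : kR x ^ 2 * lap u x ^ 2 ≤ Jx x := by
        by_cases h1 : R / 4 ≤ ‖x‖
        · refine le_trans ?_ (Jx0 x)
          rw [tailI, Set.indicator_of_mem (by simpa using h1), hF]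
          have := (hpos x).le
          have h3 : 0 ≤ ‖x‖ ^ a * u x ^ (p + 1) := by positivity
          have := mul_le_mul_of_nonneg_right (ks x) (sq_nonneg (lap u x))
          simp only
          linarith
        · have : kR x = 0 := k0 _ (by rw [nsc, div_le_iff₀ hR]; linarith)
          rw [this]; simpa using (t0 x).trans (Jx0 x)
      have hB : (2 * gd u kR x + u x * lap kR x) ^ 2 ≤ Berr u kR x := by
        unfold Berr
        have := mul_nonneg (abs_nonneg (u x * lap u x)) (chi_nonneg kR x)
        linarith
      have e : (u x * lap kR x + 2 * (∑ i, pd i u x * pd i kR x) + kR x * lap u x)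
        = (2 * gd u kR x + u x * lap kR x) + kR x * lap u x := by unfold gd; ring
      simp only [e]
      nlinarith [sq_nonneg ((2 * gd u kR x + u x * lap kR x) - kR x * lap u x)]
    refine this.trans ?_
    rw [integral_add (iJx.const_mul 2) ((Berr_int hu kR4 kRc).const_mul 2), integral_const_mul,
      integral_const_mul, eJ]
    linarith
  have T4 : ∫ x, tailI F R x ≤ J R := by
    rw [← eJ]; exact integral_mono it iJx Jx0
  have T5 : 0 ≤ J R := (integral_nonneg t0).trans T4
  refine ⟨v, v4, vc, fun x h1 h2 => ?_, it, iG, ?_⟩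
  · have o : IsOpen {y : Eu N | R / 2 < ‖y‖ ∧ ‖y‖ < 4 * R} :=
      (isOpen_lt continuous_const continuous_norm).inter (isOpen_lt continuous_norm continuous_const)
    filter_upwards [o.mem_nhds ⟨by linarith, by linarith⟩] with y hy
    simp only [hv]
    have : kR y = 1 := kone _ (by rw [nsc, le_div_iff₀ hR]; linarith [hy.1])
      (by rw [nsc, div_le_iff₀ hR]; linarith [hy.2])
    rw [this, mul_one]
  · nlinarith [mul_nonneg C2n T5]

end Annulus

section Poho
open scoped ContDiff
variable {N : ℕ}

lemma norm_rpow_deriv {a : ℝ} {x : Eu N} (hx : x ≠ 0) :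
    HasFDerivAt (fun y : Eu N => ‖y‖ ^ a) ((a * ‖x‖ ^ (a - 2)) • innerSL ℝ x) x := by
  have h1 := (hasStrictFDerivAt_norm_sq x).hasFDerivAt
  have hn : 0 < ‖x‖ := norm_pos_iff.2 hx
  have h2 := h1.rpow_const (p := a / 2) (Or.inl (by positivity))
  have e1 : ∀ (y : Eu N) (b : ℝ), (‖y‖ ^ 2) ^ b = ‖y‖ ^ (2 * b) := fun y b => by
    rw [← Real.rpow_natCast, ← Real.rpow_mul (norm_nonneg _)]; norm_num
  simp_rw [e1] at h2
  have e2 : 2 * (a / 2) = a := by ring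
  have e3 : 2 * (a / 2 - 1) = a - 2 := by ring
  rw [e3] at h2
  simp_rw [e2] at h2
  have e4 : (a / 2 * ‖x‖ ^ (a - 2)) • 2 • (innerSL ℝ) x = (a * ‖x‖ ^ (a - 2)) • innerSL ℝ x := by
    rw [two_nsmul, smul_add, ← add_smul]
    congr 1
    ring
  rw [e4] at h2
  exact h2

lemma gk_deriv {a : ℝ} (ha : 0 ≤ a) (k : Fin N) :
    Differentiable ℝ (fun x : Eu N => ‖x‖ ^ a * x k) ∧
    ∀ x : Eu N, pd k (fun x : Eu N => ‖x‖ ^ a * x k) x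
      = ‖x‖ ^ a + a * (‖x‖ ^ (a - 2) * x k ^ 2) := by
  have hk : ∀ x : Eu N, HasFDerivAt (fun x : Eu N => x k) (EuclideanSpace.proj k : Eu N →L[ℝ] ℝ) x :=
    fun x => (EuclideanSpace.proj k : Eu N →L[ℝ] ℝ).hasFDerivAt
  have H : ∀ x : Eu N, ∃ L : Eu N →L[ℝ] ℝ, HasFDerivAt (fun x : Eu N => ‖x‖ ^ a * x k) L x ∧
      L (EuclideanSpace.single k 1) = ‖x‖ ^ a + a * (‖x‖ ^ (a - 2) * x k ^ 2) := by
    intro x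
    rcases ha.eq_or_lt with h0 | h0
    · subst h0
      refine ⟨_, by simpa using hk x, by simp⟩
    by_cases hx : x = 0
    · subst hx
      refine ⟨0, ?_, by simp [Real.zero_rpow h0.ne']⟩
      rw [hasFDerivAt_iff_isLittleO_nhds_zero]
      have t : (fun h : Eu N => ‖h‖ ^ a) =o[nhds 0] (fun _ => (1 : ℝ)) := by
        rw [Asymptotics.isLittleO_one_iff]
        have : Continuous (fun h : Eu N => ‖h‖ ^ a) :=
          continuous_norm.rpow_const fun _ => Or.inr ha
        have := this.tendsto 0
        simpa [Real.zero_rpow h0.ne'] using this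
      have t2 : (fun h : Eu N => h k) =O[nhds 0] (fun h => ‖h‖) := by
        refine Asymptotics.IsBigO.of_bound 1 (Filter.Eventually.of_forall fun h => ?_)
        simpa using PiLp.norm_apply_le h k
      have := t.mul_isBigO t2
      have h3 : (fun h : Eu N => ‖h‖ ^ a * h k) =o[nhds 0] (fun h => h) := by
        rw [← Asymptotics.isLittleO_norm_right]
        simpa using this
      simpa [Real.zero_rpow h0.ne'] using h3
    · have := (norm_rpow_deriv (a := a) hx).mul (hk x)
      refine ⟨_, this, ?_⟩
      simp [EuclideanSpace.inner_single_right]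
      ring
  refine ⟨fun x => ?_, fun x => ?_⟩
  · obtain ⟨L, hL, _⟩ := H x
    exact hL.differentiableAt
  · obtain ⟨L, hL, h2⟩ := H x
    rw [← h2]
    unfold pd
    rw [hL.fderiv]

lemma rp_le {a : ℝ} (x : Eu N) (k : Fin N) : ‖x‖ ^ (a - 2) * x k ^ 2 ≤ ‖x‖ ^ a := by
  by_cases hx : x = 0
  · subst hx; simp; positivity
  have hn : 0 < ‖x‖ := norm_pos_iff.2 hx
  have h1 : x k ^ 2 ≤ ‖x‖ ^ 2 := by
    have := PiLp.norm_apply_le x k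
    rw [Real.norm_eq_abs] at this
    exact sq_le_sq' (by linarith [neg_abs_le (x k)]) ((le_abs_self _).trans this)
  calc _ ≤ ‖x‖ ^ (a - 2) * ‖x‖ ^ 2 := by gcongr
    _ = ‖x‖ ^ a := by rw [← Real.rpow_natCast, ← Real.rpow_add hn]; norm_num

lemma rp_sum {a : ℝ} (ha : 0 ≤ a) (x : Eu N) :
    ∑ k, a * (‖x‖ ^ (a - 2) * x k ^ 2) = a * ‖x‖ ^ a := by
  rcases ha.eq_or_lt with h0 | h0
  · simp [← h0]
  by_cases hx : x = 0
  · subst hx; simp [Real.zero_rpow h0.ne']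
  have hn : 0 < ‖x‖ := norm_pos_iff.2 hx
  rw [← Finset.mul_sum, ← Finset.mul_sum, ← EuclideanSpace.real_norm_sq_eq]
  rw [← Real.rpow_natCast, ← Real.rpow_add hn]; norm_num

/-- Divergence theorem for the weighted radial field. -/
lemma div_weight {a : ℝ} (ha : 0 ≤ a) {f : Eu N → ℝ} (hf : ContDiff ℝ 1 f)
    (hc : HasCompactSupport f) :
    Integrable (fun x => ‖x‖ ^ a * (((N : ℝ) + a) * f x + ∑ k, x k * pd k f x)) ∧
    ∫ x, ‖x‖ ^ a * (((N : ℝ) + a) * f x + ∑ k, x k * pd k f x) = 0 := by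
  have ca : Continuous (fun h : Eu N => ‖h‖ ^ a) := continuous_norm.rpow_const fun _ => Or.inr ha
  have cf := hf.continuous
  have ck : ∀ k : Fin N, Continuous (fun x : Eu N => x k) := fun k =>
    (coord_contDiff (n := 0) k).continuous
  set G : Fin N → Eu N → ℝ := fun k x => (‖x‖ ^ a * x k) * f x with hG
  have df := hf.differentiable (by norm_num)
  have dG : ∀ k, Differentiable ℝ (G k) := fun k => (gk_deriv ha k).1.fun_mul df
  have iG : ∀ k, Integrable (G k) := fun k => int_cc ((ca.mul (ck k)).mul cf) hc.mul_left
  have eG : ∀ k x, pd k (G k) x = (‖x‖ ^ a * x k) * pd k f x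
      + f x * (‖x‖ ^ a + a * (‖x‖ ^ (a - 2) * x k ^ 2)) := fun k x => by
    rw [hG, pd_mul (gk_deriv ha k).1 df]
    simp only [(gk_deriv ha k).2]
  have iP : ∀ k, Integrable (pd k (G k)) := fun k => by
    have j1 : Integrable (fun x => |‖x‖ ^ a * x k * pd k f x|) :=
      (int_cc ((ca.mul (ck k)).mul (pd_cont hf k)) (pd_hcs hc k).mul_left).abs
    have j2 : Integrable (fun x => (1 + a) * |‖x‖ ^ a * f x|) :=
      ((int_cc (ca.mul cf) hc.mul_left).abs).const_mul _
    refine Integrable.mono' (j1.add j2)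
      (measurable_fderiv_apply_const ℝ (G k) _).aestronglyMeasurable
      (Filter.Eventually.of_forall fun x => ?_)
    rw [eG, Real.norm_eq_abs]
    refine (abs_add_le _ _).trans ?_
    simp only [Pi.add_apply]
    gcongr
    rw [abs_mul, abs_mul (‖x‖ ^ a)]
    have h0 : 0 ≤ ‖x‖ ^ a := by positivity
    have h1 : 0 ≤ ‖x‖ ^ (a - 2) * x k ^ 2 := by positivity
    have h2 := rp_le (a := a) x k
    rw [abs_of_nonneg h0, abs_of_nonneg (a := ‖x‖ ^ a + a * (‖x‖ ^ (a - 2) * x k ^ 2)) (by positivity)]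
    have : ‖x‖ ^ a + a * (‖x‖ ^ (a - 2) * x k ^ 2) ≤ (1 + a) * ‖x‖ ^ a := by
      nlinarith
    calc _ ≤ |f x| * ((1 + a) * ‖x‖ ^ a) := by gcongr
      _ = _ := by ring
  have key : ∀ x, ‖x‖ ^ a * (((N : ℝ) + a) * f x + ∑ k, x k * pd k f x)
      = ∑ k, pd k (G k) x := fun x => by
    simp only [eG]
    rw [Finset.sum_add_distrib, ← Finset.mul_sum, Finset.sum_add_distrib, rp_sum ha]
    simp only [Finset.sum_const, Finset.card_univ, Fintype.card_fin, nsmul_eq_mul, mul_assoc]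
    rw [← Finset.mul_sum]
    ring
  simp only [key]
  refine ⟨integrable_finsetSum _ fun k _ => iP k, ?_⟩
  rw [integral_finsetSum _ fun k _ => iP k]
  exact Finset.sum_eq_zero fun k _ => int_pd_zero' (dG k) (iG k) k (iP k)

/-- Radial derivative. -/
noncomputable def xd (f : Eu N → ℝ) (x : Eu N) : ℝ := ∑ k, x k * pd k f x

lemma pd_rpow {u : Eu N → ℝ} (hu : Differentiable ℝ u) (hpos : ∀ x, 0 < u x) (q : ℝ) (k : Fin N) (x) :
    pd k (fun x => u x ^ q) x = q * u x ^ (q - 1) * pd k u x := by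
  have := ((hu x).hasFDerivAt).rpow_const (p := q) (Or.inl (hpos x).ne')
  unfold pd
  rw [this.fderiv]; simp

/-- Right-hand side of the Pohozaev identity. -/
lemma poho_rhs {a p c : ℝ} (ha : 0 ≤ a) (hp : 1 < p) {u Z : Eu N → ℝ} (hu : ContDiff ℝ 4 u)
    (hpos : ∀ x, 0 < u x) (hZ : ContDiff ℝ 4 Z) (hc : HasCompactSupport Z) :
    ∫ x, ‖x‖ ^ a * u x ^ p * (Z x * (xd u x + c * u x)) =
      (c - ((N : ℝ) + a) / (p + 1)) * (∫ x, ‖x‖ ^ a * u x ^ (p + 1) * Z x)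
        - 1 / (p + 1) * ∫ x, ‖x‖ ^ a * u x ^ (p + 1) * xd Z x := by
  have hu1 : ContDiff ℝ 1 u := hu.of_le (by norm_num)
  have hZ1 : ContDiff ℝ 1 Z := hZ.of_le (by norm_num)
  have du := hu1.differentiable (by norm_num)
  have dZ := hZ1.differentiable (by norm_num)
  have hr : ContDiff ℝ 1 (fun x => u x ^ (p + 1)) := hu1.rpow_const_of_ne fun x => (hpos x).ne'
  have dr := hr.differentiable (by norm_num)
  obtain ⟨i0, e0⟩ := div_weight ha (hr.mul hZ1) hc.mul_left
  have cW := cont_W (p := p) ha hu.continuous hpos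
  have cx : Continuous (xd Z) := by
    unfold xd
    exact continuous_finsetSum _ fun k _ => ((coord_contDiff (n := 0) k).continuous).mul (pd_cont hZ1 k)
  have i1 : Integrable (fun x => ‖x‖ ^ a * u x ^ (p + 1) * Z x) :=
    int_cc (cW.mul hZ.continuous) hc.mul_left
  have i2 : Integrable (fun x => ‖x‖ ^ a * u x ^ (p + 1) * xd Z x) :=
    int_van (cW.mul cx) hc fun x hx => by
      simp [xd, (van_all (ev_zero hx)).1]
  have pt : ∀ x, ‖x‖ ^ a * u x ^ p * (Z x * (xd u x + c * u x)) =
      1 / (p + 1) * (‖x‖ ^ a * (((N : ℝ) + a) * (u x ^ (p + 1) * Z x)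
        + ∑ k, x k * pd k (fun x => u x ^ (p + 1) * Z x) x))
      + ((c - ((N : ℝ) + a) / (p + 1)) * (‖x‖ ^ a * u x ^ (p + 1) * Z x)
        - 1 / (p + 1) * (‖x‖ ^ a * u x ^ (p + 1) * xd Z x)) := fun x => by
    have e : ∑ k, x k * pd k (fun x => u x ^ (p + 1) * Z x) x =
        u x ^ (p + 1) * xd Z x + Z x * ((p + 1) * u x ^ p) * xd u x := by
      unfold xd
      rw [pd_mul dr dZ |> fun h => Finset.sum_congr rfl fun k _ => by rw [pd_mul dr dZ k],
        Finset.mul_sum, Finset.mul_sum, ← Finset.sum_add_distrib]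
      refine Finset.sum_congr rfl fun k _ => ?_
      simp only
      rw [pd_rpow du hpos]
      simp only [add_sub_cancel_right]
      ring
    rw [e]
    have e2 : u x ^ (p + 1) = u x ^ p * u x := by
      rw [Real.rpow_add (hpos x), Real.rpow_one]
    rw [e2]
    have : p + 1 ≠ 0 := by linarith
    field_simp
    ring
  simp_rw [pt]
  have i12 : Integrable (fun x => (c - ((N : ℝ) + a) / (p + 1)) * (‖x‖ ^ a * u x ^ (p + 1) * Z x)
        - 1 / (p + 1) * (‖x‖ ^ a * u x ^ (p + 1) * xd Z x)) := (i1.const_mul _).sub (i2.const_mul _)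
  rw [integral_add (i0.const_mul _) i12,
    integral_sub (i1.const_mul _) (i2.const_mul _), integral_const_mul, integral_const_mul,
    integral_const_mul, e0]
  ring

end Poho

section PohoL
open scoped ContDiff
variable {N : ℕ}

lemma pd_xd {f : Eu N → ℝ} (hf : ContDiff ℝ 2 f) (i : Fin N) :
    pd i (xd f) = fun x => pd i f x + xd (pd i f) x := by
  have dk : ∀ k : Fin N, Differentiable ℝ (fun x : Eu N => x k) := fun k =>
    (coord_contDiff (n := 1) k).differentiable (by norm_num)
  have df : ∀ k : Fin N, Differentiable ℝ (pd k f) := fun k =>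
    (pd_c1 hf k).differentiable (by norm_num)
  have e : xd f = fun x => ∑ k, x k * pd k f x := rfl
  rw [e, pd_sum _ (f := fun k x => x k * pd k f x) fun k => (dk k).fun_mul (df k)]
  ext x
  have : ∀ k, pd i (fun x : Eu N => x k * pd k f x) x
      = x k * pd k (pd i f) x + (if k = i then pd i f x else 0) := fun k => by
    rw [pd_mul (dk k) (df k), pd_coord, pd_comm hf i k]
    simp only
    split_ifs with h
    · rw [h]; ring
    · ring
  rw [Finset.sum_congr rfl fun k _ => this k, Finset.sum_add_distrib]
  simp [xd]
  ring

lemma xd_c {n : ℕ} {f : Eu N → ℝ} (hf : ContDiff ℝ (n + 1) f) : ContDiff ℝ n (xd f) :=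
  ContDiff.sum fun k _ => (coord_contDiff k).mul (pd_contDiff hf k)

lemma lap_xd {u : Eu N → ℝ} (hu : ContDiff ℝ 4 u) (x : Eu N) :
    lap (xd u) x = 2 * lap u x + xd (lap u) x := by
  have hu2 : ContDiff ℝ 2 u := hu.of_le (by norm_num)
  have e : ∀ i, pd i (pd i (xd u)) x = 2 * pd i (pd i u) x + xd (pd i (pd i u)) x := fun i => by
    have h3 := pd_c3 hu i
    have h2 : ContDiff ℝ 2 (pd i u) := h3.of_le (by norm_num)
    have hx : ContDiff ℝ ((2 : ℕ) : WithTop ℕ∞) (xd (pd i u)) :=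
      xd_c (n := 2) (by norm_num; exact h3)
    rw [pd_xd hu2, pd_add (h2.differentiable (by norm_num)) (hx.differentiable (by norm_num)),
      pd_xd h2]
    ring
  rw [lap_eq, Finset.sum_congr rfl fun i _ => e i, Finset.sum_add_distrib, ← Finset.mul_sum,
    ← lap_eq]
  congr 1
  have l : lap u = fun x => ∑ i, pd i (pd i u) x := rfl
  rw [l]
  unfold xd
  have hd : ∀ i : Fin N, Differentiable ℝ (pd i (pd i u)) := fun i =>
    (pd_c2 (pd_c3 hu i) i).differentiable (by norm_num)
  rw [Finset.sum_comm]
  refine Finset.sum_congr rfl fun k _ => ?_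
  rw [pd_sum _ hd, Finset.mul_sum]

noncomputable def hh (c : ℝ) (u : Eu N → ℝ) : Eu N → ℝ := fun x => xd u x + c * u x

lemma hh_c3 {c : ℝ} {u : Eu N → ℝ} (hu : ContDiff ℝ 4 u) : ContDiff ℝ 3 (hh c u) := by
  have hx : ContDiff ℝ ((3 : ℕ) : WithTop ℕ∞) (xd u) := xd_c (n := 3) (by norm_num; exact hu)
  have hx3 : ContDiff ℝ 3 (xd u) := by exact_mod_cast hx
  exact hx3.add (contDiff_const.mul (hu.of_le (by norm_num)))

lemma pd_hh {c : ℝ} {u : Eu N → ℝ} (hu : ContDiff ℝ 4 u) (i : Fin N) (x : Eu N) :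
    pd i (hh c u) x = (1 + c) * pd i u x + xd (pd i u) x := by
  have hx : ContDiff ℝ ((3 : ℕ) : WithTop ℕ∞) (xd u) := xd_c (n := 3) (by norm_num; exact hu)
  have du := hu.differentiable (by norm_num)
  have e : hh c u = fun x => xd u x + c * u x := rfl
  rw [e, pd_add (hx.differentiable (by norm_num)) (du.const_mul c), pd_const_mul du,
    pd_xd (hu.of_le (by norm_num))]
  ring

lemma lap_hh {c : ℝ} {u : Eu N → ℝ} (hu : ContDiff ℝ 4 u) (x : Eu N) :
    lap (hh c u) x = (2 + c) * lap u x + xd (lap u) x := by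
  have hx : ContDiff ℝ ((3 : ℕ) : WithTop ℕ∞) (xd u) := xd_c (n := 3) (by norm_num; exact hu)
  have du := hu.differentiable (by norm_num)
  have hu2 : ContDiff ℝ 2 u := hu.of_le (by norm_num)
  have : lap (hh c u) x = lap (xd u) x + c * lap u x := by
    simp only [lap_eq, Finset.mul_sum]
    rw [← Finset.sum_add_distrib]
    refine Finset.sum_congr rfl fun i _ => ?_
    have e : hh c u = fun x => xd u x + c * u x := rfl
    have d1 : Differentiable ℝ (pd i (xd u)) :=
      (pd_contDiff (n := 2) (by exact_mod_cast hx) i).differentiable (by norm_num)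
    have d2 : Differentiable ℝ (pd i u) := (pd_c1 hu2 i).differentiable (by norm_num)
    rw [e, pd_add (hx.differentiable (by norm_num)) (du.const_mul c), pd_const_mul du,
      pd_add d1 (d2.const_mul c), pd_const_mul d2]
  rw [this, lap_xd hu]; ring

noncomputable def E1 (c : ℝ) (u Z : Eu N → ℝ) (x : Eu N) : ℝ :=
  lap u x * (2 * gd Z (hh c u) x + hh c u x * lap Z x) - 1 / 2 * (lap u x ^ 2 * xd Z x)

lemma poho_lhs {c : ℝ} (hcN : 2 + c = (N : ℝ) / 2) {u Z : Eu N → ℝ} (hu : ContDiff ℝ 4 u)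
    (hZ : ContDiff ℝ 4 Z) (hc : HasCompactSupport Z) :
    Integrable (E1 c u Z) ∧
    ∫ x, lap (lap u) x * (Z x * hh c u x) = ∫ x, E1 c u Z x := by
  have hw := lap_c2 hu
  have hw1 : ContDiff ℝ 1 (lap u) := hw.of_le (by norm_num)
  have hZ2 : ContDiff ℝ 2 Z := hZ.of_le (by norm_num)
  have hZ1 : ContDiff ℝ 1 Z := hZ.of_le (by norm_num)
  have hh2 : ContDiff ℝ 2 (hh c u) := (hh_c3 hu).of_le (by norm_num)
  have hh1 : ContDiff ℝ 1 (hh c u) := (hh_c3 hu).of_le (by norm_num)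
  have dw := hw1.differentiable (by norm_num)
  have dZ := hZ1.differentiable (by norm_num)
  have cxZ : Continuous (xd Z) :=
    (xd_c (n := 0) (by norm_num; exact hZ1)).continuous
  have i1 : Integrable (E1 c u Z) := by
    refine int_van (η := Z) ?_ hc fun x hx => ?_
    · have c1 := hw.continuous
      have c2 : Continuous (gd Z (hh c u)) := gd_cont hZ1 hh1
      have c3 := hh1.continuous
      have c4 := lap_cont hZ2
      unfold E1
      fun_prop
    · obtain ⟨v1, v2, _, _⟩ := van_all (ev_zero hx)
      simp [E1, gd, xd, v1, v2]
  refine ⟨i1, ?_⟩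
  rw [green hw (hZ2.mul hh2) hc.mul_right]
  have h2 : ContDiff ℝ 1 (fun x => Z x * lap u x ^ 2) := hZ1.mul (hw1.pow 2)
  obtain ⟨j0, j1⟩ := div_weight (a := 0) le_rfl h2 hc.mul_right
  simp only [Real.rpow_zero, one_mul, add_zero] at j0 j1
  have pt : ∀ x, lap u x * lap (fun x => Z x * hh c u x) x = E1 c u Z x + 1 / 2 *
      ((N : ℝ) * (Z x * lap u x ^ 2) + ∑ k, x k * pd k (fun x => Z x * lap u x ^ 2) x) := fun x => by
    have e : ∑ k, x k * pd k (fun x => Z x * lap u x ^ 2) x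
        = lap u x ^ 2 * xd Z x + 2 * (Z x * lap u x) * xd (lap u) x := by
      unfold xd
      rw [Finset.mul_sum, Finset.mul_sum, ← Finset.sum_add_distrib]
      refine Finset.sum_congr rfl fun k _ => ?_
      rw [pd_mul dZ (dw.fun_pow 2)]
      have e2 : (fun x => lap u x ^ 2) = fun x => lap u x * lap u x := by ext; ring
      rw [e2, pd_mul dw dw]
      ring
    rw [e, lap_mul hZ2 hh2]
    simp only [lap_hh hu]
    unfold E1 gd
    have : (N : ℝ) = 2 * (2 + c) := by linarith
    rw [this]
    ring
  simp_rw [pt]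
  rw [integral_add i1 (j0.const_mul _), integral_const_mul, j1]
  ring

lemma prod_bd {w m G : ℝ} (h : w ^ 2 + m ^ 2 ≤ G) : |w| * |m| ≤ G := by
  nlinarith [sq_abs w, sq_abs m, sq_nonneg (|w| - |m|), abs_nonneg w, abs_nonneg m]

/-- Pointwise error bound on the annulus. -/
lemma err_bd {c R D : ℝ} (hR : 0 < R) (hD : 0 ≤ D) {u v ζ : Eu N → ℝ} (hu : ContDiff ℝ 4 u)
    (hζ : ContDiff ℝ 4 ζ) (hb : ∀ y i, |pd i ζ y| ≤ D) (hl : ∀ y, |lap ζ y| ≤ D) {x : Eu N}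
    (hx : ‖x‖ ≤ 2 * R) (hv : u =ᶠ[nhds x] v) :
    |xd (sc R ζ) x| ≤ 2 * N * D ∧
    |lap u x * (2 * gd (sc R ζ) (hh c u) x + hh c u x * lap (sc R ζ) x)| ≤
      D * (2 * |1 + c| * N + 4 * (N * N) + 2 * N + |c|) * Gq R v x := by
  have hxk : ∀ k, |x k| ≤ 2 * R := fun k => by
    have := PiLp.norm_apply_le x k
    rw [Real.norm_eq_abs] at this
    linarith
  have Rp : 0 < R⁻¹ := inv_pos.2 hR
  have RR : R⁻¹ * R = 1 := inv_mul_cancel₀ hR.ne'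
  have p1 : ∀ i, |pd i (sc R ζ) x| ≤ R⁻¹ * D := fun i => by
    rw [pd_sc, abs_mul, abs_of_pos Rp]
    exact mul_le_mul_of_nonneg_left (hb _ i) Rp.le
  have p2 : |lap (sc R ζ) x| ≤ R⁻¹ ^ 2 * D := by
    rw [lap_sc R (hζ.of_le (by norm_num)), abs_mul, abs_of_nonneg (by positivity : 0 ≤ R⁻¹ ^ 2)]
    exact mul_le_mul_of_nonneg_left (hl _) (by positivity)
  constructor
  · unfold xd
    refine (Finset.abs_sum_le_sum_abs _ _).trans ?_
    calc _ ≤ ∑ k : Fin N, (2 * R) * (R⁻¹ * D) := by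
          refine Finset.sum_le_sum fun k _ => ?_
          rw [abs_mul]
          exact mul_le_mul (hxk k) (p1 k) (abs_nonneg _) (by positivity)
      _ = 2 * N * D := by
          simp only [Finset.sum_const, Finset.card_univ, Fintype.card_fin, nsmul_eq_mul]
          linear_combination (2 * N * D) * RR
  -- translate the quadratic quantity
  have q1 : ∀ i, pd i v x = pd i u x := fun i => (pd_congr hv i).eq_of_nhds.symm
  have q2 : ∀ i j, pd i (pd j v) x = pd i (pd j u) x := fun i j =>
    (pd_congr (pd_congr hv j) i).eq_of_nhds.symm
  have q3 : lap v x = lap u x := (lap_congr hv).symm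
  set G := Gq R v x with hG
  have eG : G = lap u x ^ 2 + R⁻¹ ^ 4 * u x ^ 2 + R⁻¹ ^ 2 * (∑ i, (pd i u x) ^ 2)
      + ∑ i, ∑ j, (pd i (pd j u) x) ^ 2 := by
    rw [hG]; unfold Gq
    simp only [q1, q2, q3, hv.eq_of_nhds]
  have s1 : 0 ≤ R⁻¹ ^ 4 * u x ^ 2 := by positivity
  have s2 : 0 ≤ R⁻¹ ^ 2 * (∑ i, (pd i u x) ^ 2) :=
    mul_nonneg (by positivity) (Finset.sum_nonneg fun i _ => sq_nonneg _)
  have s3 : 0 ≤ ∑ i, ∑ j, (pd i (pd j u) x) ^ 2 :=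
    Finset.sum_nonneg fun i _ => Finset.sum_nonneg fun j _ => sq_nonneg _
  have m1 : ∀ i, |lap u x| * (R⁻¹ * |pd i u x|) ≤ G := fun i => by
    have := Finset.single_le_sum (f := fun i => (pd i u x) ^ 2) (fun i _ => sq_nonneg _)
      (Finset.mem_univ i)
    have h1 := mul_le_mul_of_nonneg_left this (by positivity : 0 ≤ R⁻¹ ^ 2)
    have h2 := prod_bd (w := lap u x) (m := R⁻¹ * pd i u x) (G := G) (by
      rw [eG, mul_pow]; linarith)
    rwa [abs_mul, abs_of_pos Rp] at h2
  have m2 : ∀ i k, |lap u x| * |pd k (pd i u) x| ≤ G := fun i k => by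
    have t1 := Finset.single_le_sum (f := fun j => (pd k (pd j u) x) ^ 2) (fun i _ => sq_nonneg _)
      (Finset.mem_univ i)
    have t2 := Finset.single_le_sum (f := fun k => ∑ j, (pd k (pd j u) x) ^ 2)
      (fun i _ => Finset.sum_nonneg fun j _ => sq_nonneg _) (Finset.mem_univ k)
    exact prod_bd (by rw [eG]; linarith)
  have m3 : |lap u x| * (R⁻¹ ^ 2 * |u x|) ≤ G := by
    have h2 := prod_bd (w := lap u x) (m := R⁻¹ ^ 2 * u x) (G := G) (by
      rw [eG, mul_pow, ← pow_mul]; linarith)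
    rwa [abs_mul, abs_of_nonneg (by positivity : 0 ≤ R⁻¹ ^ 2)] at h2
  have w0 := abs_nonneg (lap u x)
  -- gradient term
  have g1 : |lap u x| * |gd (sc R ζ) (hh c u) x| ≤ D * (|1 + c| * N + 2 * (N * N)) * G := by
    unfold gd
    calc _ ≤ |lap u x| * ∑ i, |pd i (sc R ζ) x * pd i (hh c u) x| :=
          mul_le_mul_of_nonneg_left (Finset.abs_sum_le_sum_abs _ _) w0
      _ ≤ ∑ i : Fin N, D * (|1 + c| * G + 2 * (N * G)) := by
          rw [Finset.mul_sum]
          refine Finset.sum_le_sum fun i _ => ?_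
          have b : |pd i (hh c u) x| ≤ |1 + c| * |pd i u x| + 2 * R * ∑ k, |pd k (pd i u) x| := by
            rw [pd_hh hu]
            refine (abs_add_le _ _).trans ?_
            rw [abs_mul, Finset.mul_sum]
            gcongr
            unfold xd
            refine (Finset.abs_sum_le_sum_abs _ _).trans ?_
            refine Finset.sum_le_sum fun k _ => ?_
            rw [abs_mul]
            exact mul_le_mul_of_nonneg_right (hxk k) (abs_nonneg _)
          have S : ∑ k, |lap u x| * |pd k (pd i u) x| ≤ N * G := by
            refine (Finset.sum_le_sum fun k _ => m2 i k).trans ?_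
            simp
          rw [← Finset.mul_sum] at S
          calc _ ≤ |lap u x| * ((R⁻¹ * D) * (|1 + c| * |pd i u x|
                + 2 * R * ∑ k, |pd k (pd i u) x|)) := by
                rw [abs_mul]
                exact mul_le_mul_of_nonneg_left (mul_le_mul (p1 i) b (abs_nonneg _)
                  (by positivity)) w0
            _ = D * (|1 + c| * (|lap u x| * (R⁻¹ * |pd i u x|))
                + 2 * (|lap u x| * ∑ k, |pd k (pd i u) x|)) := by
                linear_combination (2 * D * |lap u x| * ∑ k, |pd k (pd i u) x|) * RR
            _ ≤ _ := by
                have := m1 i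
                gcongr
      _ = _ := by
          simp only [Finset.sum_const, Finset.card_univ, Fintype.card_fin, nsmul_eq_mul]
          ring
  have g2 : |lap u x| * (|hh c u x| * |lap (sc R ζ) x|) ≤ D * (2 * N + |c|) * G := by
    have b : |hh c u x| ≤ 2 * R * (∑ k, |pd k u x|) + |c| * |u x| := by
      unfold hh
      refine (abs_add_le _ _).trans ?_
      rw [abs_mul c, Finset.mul_sum]
      gcongr
      unfold xd
      refine (Finset.abs_sum_le_sum_abs _ _).trans ?_
      refine Finset.sum_le_sum fun k _ => ?_
      rw [abs_mul]
      exact mul_le_mul_of_nonneg_right (hxk k) (abs_nonneg _)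
    have S : ∑ k, |lap u x| * (R⁻¹ * |pd k u x|) ≤ N * G := by
      refine (Finset.sum_le_sum fun k _ => m1 k).trans ?_
      simp
    rw [← Finset.mul_sum, ← Finset.mul_sum] at S
    calc _ ≤ |lap u x| * ((2 * R * (∑ k, |pd k u x|) + |c| * |u x|) * (R⁻¹ ^ 2 * D)) :=
          mul_le_mul_of_nonneg_left (mul_le_mul b p2 (abs_nonneg _) (by positivity)) w0
      _ = D * (2 * (|lap u x| * (R⁻¹ * ∑ k, |pd k u x|)) + |c| * (|lap u x| * (R⁻¹ ^ 2 * |u x|))) := by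
          linear_combination (2 * D * |lap u x| * (∑ k, |pd k u x|) * R⁻¹) * RR
      _ ≤ D * (2 * (N * G) + |c| * G) := by gcongr
      _ = _ := by ring
  calc _ ≤ |lap u x| * (2 * |gd (sc R ζ) (hh c u) x| + |hh c u x| * |lap (sc R ζ) x|) := by
        rw [abs_mul]
        refine mul_le_mul_of_nonneg_left ((abs_add_le _ _).trans ?_) w0
        rw [abs_mul, abs_mul, abs_two]
    _ ≤ _ := by linarith

end PohoL

section Final
open scoped ContDiff

set_option maxHeartbeats 1600000 in
theorem no_sol (N : ℕ) (hN : 5 ≤ N) {a p : ℝ} (ha : 0 ≤ a) (hp : 1 < p)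
    (hsub : p < ((N : ℝ) + 4 + 2 * a) / ((N : ℝ) - 4))
    {u : Eu N → ℝ} (hu : ContDiff ℝ 4 u) (hpos : ∀ x, 0 < u x)
    (heq : ∀ x, lap (lap u) x = ‖x‖ ^ a * u x ^ p)
    {K : Set (Eu N)} (hK : IsCompact K)
    (hst : ∀ φ : Eu N → ℝ, ContDiff ℝ 4 φ → HasCompactSupport φ → Disjoint (tsupport φ) K →
            0 ≤ (∫ x, (lap φ x) ^ 2) - p * ∫ x, ‖x‖ ^ a * u x ^ (p - 1) * φ x ^ 2) : False := by
  have hN' : (5 : ℝ) ≤ N := by exact_mod_cast hN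
  have hs : p * ((N : ℝ) - 4) < (N : ℝ) + 4 + 2 * a := (lt_div_iff₀ (by linarith)).1 hsub
  have hp1 : 0 < p - 1 := by linarith
  have hneg : (N : ℝ) - 4 - (8 + 2 * a) / (p - 1) < 0 := by
    rw [sub_neg, lt_div_iff₀ hp1]; linarith
  set F : Eu N → ℝ := fun x => (lap u x) ^ 2 + ‖x‖ ^ a * u x ^ (p + 1) with hF
  have iF : Integrable F := energy_finite N ha hp hneg hu hpos heq hK hst
  obtain ⟨e, he, hann⟩ := annulus N ha hp hneg hu hpos hF iF
  obtain ⟨ζ, hζ, z0, z1, zone, ztwo⟩ := exists_zeta N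
  have ζ4 := smooth4 hζ
  have ζ1 : ContDiff ℝ 1 ζ := ζ4.of_le (by norm_num)
  -- bounds on derivatives of the cutoff
  obtain ⟨D, hD, hDb, hDl⟩ : ∃ D, 0 ≤ D ∧ (∀ y i, |pd i ζ y| ≤ D) ∧ ∀ y, |lap ζ y| ≤ D := by
    choose B hB bB using fun i : Fin N => bdd_ball (pd_cont ζ1 i) 2
    obtain ⟨L, hL, bL⟩ := bdd_ball (lap_cont (ζ4.of_le (by norm_num))) 2
    have hS : 0 ≤ ∑ i, B i := Finset.sum_nonneg fun i _ => hB i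
    refine ⟨(∑ i, B i) + L, by positivity, fun y i => ?_, fun y => ?_⟩
    · by_cases hy : ‖y‖ ≤ 2
      · have h1 := bB i y hy
        have h2 := Finset.single_le_sum (fun i _ => hB i) (Finset.mem_univ i)
        linarith
      · rw [(van_all (ev_of_gt ztwo (not_le.1 hy))).1 i, abs_zero]; positivity
    · by_cases hy : ‖y‖ ≤ 2
      · have h1 := bL y hy
        linarith
      · rw [(van_all (ev_of_gt ztwo (not_le.1 hy))).2.1, abs_zero]; positivity
  set c : ℝ := (N : ℝ) / 2 - 2 with hc
  have cW := cont_W (p := p) ha hu.continuous hpos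
  have W0 : ∀ x : Eu N, 0 ≤ ‖x‖ ^ a * u x ^ (p + 1) := fun x => by
    have := (hpos x).le
    positivity
  have F0 : ∀ x, 0 ≤ F x := fun x => add_nonneg (sq_nonneg _) (W0 x)
  set Q := D * (2 * |1 + c| * N + 4 * (N * N) + 2 * N + |c|) with hQ
  have Q0 : 0 ≤ Q := by positivity
  set Cf := 2 * (2 * N * D) + Q with hCf
  -- the main inequality
  have main : ∀ R, 1 ≤ R → (((N : ℝ) + a) / (p + 1) - c) *
      (∫ x in Metric.closedBall (0 : Eu N) 1, ‖x‖ ^ a * u x ^ (p + 1)) ≤ Cf * e R := by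
    intro R hR1
    have hR : 0 < R := by linarith
    obtain ⟨v, v4, vc, huv, it, iG, hb⟩ := hann R hR
    have nsc : ∀ x : Eu N, ‖R⁻¹ • x‖ = ‖x‖ / R := fun x => by
      rw [norm_smul, norm_inv, Real.norm_of_nonneg hR.le]; ring
    set Z := sc R ζ with hZ
    have Z4 : ContDiff ℝ 4 Z := sc_contDiff ζ4 R
    have Zc : HasCompactSupport Z := sc_hcs (hcs_of_zero ztwo) hR
    obtain ⟨iE, L⟩ := poho_lhs (c := c) (by rw [hc]; ring) hu Z4 Zc
    have Rr := poho_rhs (c := c) ha hp hu hpos Z4 Zc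
    simp_rw [heq] at L
    have L' := L.symm.trans Rr
    have cxZ : Continuous (xd Z) :=
      (xd_c (n := 0) (by norm_num; exact Z4.of_le (by norm_num))).continuous
    have i2 : Integrable (fun x => ‖x‖ ^ a * u x ^ (p + 1) * xd Z x) :=
      int_van (cW.mul cxZ) Zc fun x hx => by
        simp [xd, (van_all (ev_zero hx)).1]
    have iWZ : Integrable (fun x => ‖x‖ ^ a * u x ^ (p + 1) * Z x) :=
      int_cc (cW.mul Z4.continuous) Zc.mul_left
    have err : |(∫ x, E1 c u Z x) + 1 / (p + 1) * ∫ x, ‖x‖ ^ a * u x ^ (p + 1) * xd Z x|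
        ≤ Cf * e R := by
      rw [← integral_const_mul, ← integral_add iE (i2.const_mul _), ← Real.norm_eq_abs]
      have : Cf * ((∫ x, tailI F R x) + ∫ x, Gq R v x) ≤ Cf * e R :=
        mul_le_mul_of_nonneg_left hb (by positivity)
      refine le_trans ?_ this
      rw [← integral_add it iG, ← integral_const_mul]
      refine norm_integral_le_of_norm_le ((it.add iG).const_mul Cf)
        (Filter.Eventually.of_forall fun x => ?_)
      have tn : 0 ≤ tailI F R x := Set.indicator_nonneg (fun x _ => F0 x) x
      have gn : 0 ≤ Gq R v x := by
        unfold Gq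
        have s2 : 0 ≤ R⁻¹ ^ 2 * (∑ i, (pd i v x) ^ 2) :=
          mul_nonneg (by positivity) (Finset.sum_nonneg fun i _ => sq_nonneg _)
        have s3 : 0 ≤ ∑ i, ∑ j, (pd i (pd j v) x) ^ 2 :=
          Finset.sum_nonneg fun i _ => Finset.sum_nonneg fun j _ => sq_nonneg _
        positivity
      have zer : (∃ t, ζ =ᶠ[nhds (R⁻¹ • x)] fun _ => t) →
          ‖E1 c u Z x + 1 / (p + 1) * (‖x‖ ^ a * u x ^ (p + 1) * xd Z x)‖ ≤
          Cf * (tailI F R x + Gq R v x) := by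
        rintro ⟨t, ht⟩
        obtain ⟨v1, v2, _, _⟩ := van_all ht
        have w1 : ∀ i, pd i Z x = 0 := fun i => by rw [hZ, pd_sc]; simp [sc, v1]
        have w2 : lap Z x = 0 := by
          rw [hZ, lap_sc R (ζ4.of_le (by norm_num))]; simp [sc, v2]
        have : E1 c u Z x + 1 / (p + 1) * (‖x‖ ^ a * u x ^ (p + 1) * xd Z x) = 0 := by
          simp [E1, gd, xd, w1, w2]
        rw [this, norm_zero]
        positivity
      by_cases hx1 : ‖x‖ < R
      · exact zer ⟨1, ev_of_lt zone (by rw [nsc]; exact (div_lt_one hR).2 hx1)⟩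
      by_cases hx2 : 2 * R < ‖x‖
      · exact zer ⟨0, ev_of_gt ztwo (by rw [nsc]; exact (lt_div_iff₀ hR).2 hx2)⟩
      push Not at hx1 hx2
      obtain ⟨b1, b2⟩ := err_bd (c := c) hR hD hu ζ4 hDb hDl hx2 (huv x hx1 hx2)
      have et : tailI F R x = lap u x ^ 2 + ‖x‖ ^ a * u x ^ (p + 1) := by
        rw [tailI, Set.indicator_of_mem]
        change R / 4 ≤ ‖x‖
        linarith
      rw [← hZ] at b1 b2
      rw [← hQ] at b2
      set X := xd Z x
      set W := ‖x‖ ^ a * u x ^ (p + 1) with hW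
      have hW0 : 0 ≤ W := W0 x
      have hp2 : 1 / (p + 1) ≤ 1 := by rw [div_le_one (by linarith)]; linarith
      have hp0 : 0 ≤ 1 / (p + 1) := by positivity
      have k1 : |1 / (p + 1) * (W * X)| ≤ W * (2 * N * D) := by
        rw [abs_mul, abs_mul, abs_of_nonneg hp0, abs_of_nonneg hW0]
        have : W * |X| ≤ W * (2 * N * D) := mul_le_mul_of_nonneg_left b1 hW0
        have := mul_le_mul_of_nonneg_right hp2 (mul_nonneg hW0 (abs_nonneg X))
        linarith
      have k2 : |1 / 2 * (lap u x ^ 2 * X)| ≤ lap u x ^ 2 * (2 * N * D) := by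
        rw [abs_mul, abs_mul, abs_of_nonneg (sq_nonneg (lap u x)),
          abs_of_nonneg (by norm_num : (0 : ℝ) ≤ 1 / 2)]
        have := mul_le_mul_of_nonneg_left b1 (sq_nonneg (lap u x))
        have := mul_nonneg (sq_nonneg (lap u x)) (abs_nonneg X)
        linarith
      rw [Real.norm_eq_abs]
      unfold E1
      have k3 := abs_add_le (lap u x * (2 * gd Z (hh c u) x + hh c u x * lap Z x)
        - 1 / 2 * (lap u x ^ 2 * X)) (1 / (p + 1) * (W * X))
      have k4 := abs_sub (lap u x * (2 * gd Z (hh c u) x + hh c u x * lap Z x))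
        (1 / 2 * (lap u x ^ 2 * X))
      have k5 : 0 ≤ (2 * N * D) * tailI F R x := by positivity
      have k6 : 0 ≤ 2 * (2 * N * D) * Gq R v x := by positivity
      have k7 : 0 ≤ Q * tailI F R x := by positivity
      have k8 : (2 * N * D) * tailI F R x = lap u x ^ 2 * (2 * N * D) + W * (2 * N * D) := by
        rw [et]; ring
      rw [hCf]
      nlinarith
    have low : (∫ x in Metric.closedBall (0 : Eu N) 1, ‖x‖ ^ a * u x ^ (p + 1)) ≤
        ∫ x, ‖x‖ ^ a * u x ^ (p + 1) * Z x := by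
      rw [← integral_indicator Metric.isClosed_closedBall.measurableSet]
      refine integral_mono ?_ iWZ fun x => ?_
      · rw [integrable_indicator_iff Metric.isClosed_closedBall.measurableSet]
        exact (cW.continuousOn).integrableOn_compact (isCompact_closedBall _ _)
      · by_cases hx : x ∈ Metric.closedBall (0 : Eu N) 1
        · rw [Set.indicator_of_mem hx]
          have : Z x = 1 := zone _ (by
            rw [nsc]; exact (div_le_one hR).2 (le_trans (by simpa using hx) hR1))
          simp only [this, mul_one]; exact le_rfl
        · rw [Set.indicator_of_notMem hx]
          exact mul_nonneg (W0 x) (z0 _)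
    have hco : 0 ≤ ((N : ℝ) + a) / (p + 1) - c := by
      rw [sub_nonneg, le_div_iff₀ (by linarith), hc]; nlinarith
    refine (mul_le_mul_of_nonneg_left low hco).trans (le_trans ?_ err)
    rw [L']
    refine le_trans (le_of_eq ?_) (neg_le_abs _)
    ring
  -- conclusion
  have mpos : 0 < ∫ x in Metric.closedBall (0 : Eu N) 1, ‖x‖ ^ a * u x ^ (p + 1) := by
    rw [setIntegral_pos_iff_support_of_nonneg_ae (Filter.Eventually.of_forall fun x => W0 x)
      ((cW.continuousOn).integrableOn_compact (isCompact_closedBall _ _))]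
    have i0 : Fin N := ⟨0, by omega⟩
    set y : Eu N := EuclideanSpace.single i0 (1 / 2) with hy
    have ny : ‖y‖ = 1 / 2 := by rw [hy, EuclideanSpace.norm_single]; norm_num
    refine lt_of_lt_of_le (Metric.measure_ball_pos volume y (by norm_num : (0 : ℝ) < 1 / 2))
      (measure_mono fun x hx => ?_)
    rw [mem_ball_iff_norm] at hx
    have h1 : ‖x‖ ≤ ‖x - y‖ + ‖y‖ := by simpa using norm_add_le (x - y) y
    have h2 : ‖y‖ ≤ ‖x - y‖ + ‖x‖ := by
      have := norm_add_le (y - x) x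
      rw [norm_sub_rev y x] at this
      simpa using this
    refine ⟨?_, by rw [mem_closedBall_zero_iff]; linarith⟩
    have h3 : 0 < ‖x‖ := by linarith
    have := hpos x
    rw [Function.mem_support]
    positivity
  have hco : 0 < ((N : ℝ) + a) / (p + 1) - c := by
    rw [sub_pos, lt_div_iff₀ (by linarith), hc]; nlinarith
  have lim : Filter.Tendsto (fun R => Cf * e R) Filter.atTop (nhds 0) := by
    simpa using he.const_mul Cf
  have := ge_of_tendsto lim (Filter.eventually_atTop.2 ⟨1, main⟩)
  have := mul_pos hco mpos
  linarith

end Final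

/-- **No finite-Morse-index positive solution of the fourth-order Hénon equation below the
critical exponent.** If `a ≥ 0`, `N ≥ 5` and `1 < p < (N+4+2a)/(N-4)`, then `Δ²u = |x|^a u^p`
on `ℝ^N` has no positive `C⁴` solution which is stable outside some compact set `Σ`, i.e. such
that `∫ |Δφ|² - p ∫ |x|^a u^(p-1) φ² ≥ 0` for every `C⁴` test function `φ` compactly supported
in `ℝ^N ∖ Σ`.  (Every solution of finite Morse index is stable outside a compact set.) -/
theorem fourth_order_henon_no_finite_morse_index_positive_solution
    (N : ℕ) (hN : 5 ≤ N) (a p : ℝ) (ha : 0 ≤ a) (hp : 1 < p)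
    (hsub : p < ((N : ℝ) + 4 + 2 * a) / ((N : ℝ) - 4)) :
    ¬ ∃ u : EuclideanSpace ℝ (Fin N) → ℝ,
        ContDiff ℝ 4 u ∧ (∀ x, 0 < u x) ∧
        (∀ x, lap (lap u) x = ‖x‖ ^ a * u x ^ p) ∧
        (∃ K : Set (EuclideanSpace ℝ (Fin N)), IsCompact K ∧
          ∀ φ : EuclideanSpace ℝ (Fin N) → ℝ,
            ContDiff ℝ 4 φ → HasCompactSupport φ → Disjoint (tsupport φ) K →
            0 ≤ (∫ x, (lap φ x) ^ 2) - p * ∫ x, ‖x‖ ^ a * u x ^ (p - 1) * φ x ^ 2) := by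
  rintro ⟨u, hu, hpos, heq, K, hK, hst⟩
  exact no_sol N hN ha hp hsub hu hpos heq hK hst
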